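/- arXiv:1411.3498 — 2 statements merged into one kernel-verified Lean document; each statement's English description precedes it below -/
import Mathlib

section
/- Let R = ℂ[x_{ijk} : i ∈ {1,2,3}, j ∈ {1,2,3}, k ∈ {1,2,3}] and let G = SL_3(ℂ) × SL_3(ℂ) × SL_3(ℂ) act on R by ℂ-algebra automorphisms determined by the linear substitution (g_1,g_2,g_3)·x_{ijk} = Σ_{i',j',k'} (g_1)_{i'i}(g_2)_{j'j}(g_3)_{k'k} x_{i'j'k'}. For every natural number d, the ℂ-vector space of polynomials in R that are homogeneous of degree d and fixed by every element of G has dimension equal to the number of triples (a,b,c) of natural numbers with 6a + 9b + 12c = d. (By Kac's theorem the invariant algebra is free on generators of degrees 6, 9, 12; equivalently, the generating series of the rectangular Kronecker coefficients g(n^3,n^3,n^3) is Σ_n g(n^3,n^3,n^3) q^n = 1/((1−q^2)(1−q^3)(1−q^4)), the case of the affine Dynkin diagram Ê_6.) -/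
noncomputable section

/-- The action of `(g₁, g₂, g₃) ∈ SL_{n₁}(ℂ) × SL_{n₂}(ℂ) × SL_{n₃}(ℂ)` on the
polynomial ring `ℂ[x_v : v ∈ Fin n₁ × Fin n₂ × Fin n₃]` by the linear substitution
`x_{ijk} ↦ ∑_{i',j',k'} (g₁)_{i'i} (g₂)_{j'j} (g₃)_{k'k} x_{i'j'k'}`. -/
def act (n₁ n₂ n₃ : ℕ)
    (g : Matrix.SpecialLinearGroup (Fin n₁) ℂ × Matrix.SpecialLinearGroup (Fin n₂) ℂ ×
      Matrix.SpecialLinearGroup (Fin n₃) ℂ) :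
    MvPolynomial (Fin n₁ × Fin n₂ × Fin n₃) ℂ →ₐ[ℂ] MvPolynomial (Fin n₁ × Fin n₂ × Fin n₃) ℂ :=
  MvPolynomial.aeval fun v : Fin n₁ × Fin n₂ × Fin n₃ =>
    ∑ w : Fin n₁ × Fin n₂ × Fin n₃,
      (g.1.val w.1 v.1 * g.2.1.val w.2.1 v.2.1 * g.2.2.val w.2.2 v.2.2) •
        (MvPolynomial.X w : MvPolynomial (Fin n₁ × Fin n₂ × Fin n₃) ℂ)

/-- The space of polynomials homogeneous of degree `d` fixed by every element of
`SL_{n₁}(ℂ) × SL_{n₂}(ℂ) × SL_{n₃}(ℂ)`. -/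
def invSpace (n₁ n₂ n₃ d : ℕ) :
    Submodule ℂ (MvPolynomial (Fin n₁ × Fin n₂ × Fin n₃) ℂ) :=
  MvPolynomial.homogeneousSubmodule (Fin n₁ × Fin n₂ × Fin n₃) ℂ d ⊓
    ⨅ g : Matrix.SpecialLinearGroup (Fin n₁) ℂ × Matrix.SpecialLinearGroup (Fin n₂) ℂ ×
        Matrix.SpecialLinearGroup (Fin n₃) ℂ,
      LinearMap.eqLocus (act n₁ n₂ n₃ g).toLinearMap LinearMap.id

open MvPolynomial

namespace TensorInvariants

/-- The index set of the coordinates of `ℂ³ ⊗ ℂ³ ⊗ ℂ³`. -/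
abbrev Idx := Fin 3 × Fin 3 × Fin 3

/-- A triple of matrices acting on the coefficients of a tensor. -/
def gact (A B C : Matrix (Fin 3) (Fin 3) ℂ) (x : Idx → ℂ) : Idx → ℂ := fun v =>
  ∑ w : Idx, (A w.1 v.1 * B w.2.1 v.2.1 * C w.2.2 v.2.2) * x w

theorem eval_act (g : Matrix.SpecialLinearGroup (Fin 3) ℂ × Matrix.SpecialLinearGroup (Fin 3) ℂ ×
      Matrix.SpecialLinearGroup (Fin 3) ℂ) (f : MvPolynomial Idx ℂ) (x : Idx → ℂ) :
    eval x (act 3 3 3 g f) = eval (gact g.1.val g.2.1.val g.2.2.val x) f := by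
  have h : ((aeval x).comp (act 3 3 3 g) : MvPolynomial Idx ℂ →ₐ[ℂ] ℂ) =
      aeval (gact g.1.val g.2.1.val g.2.2.val x) := by
    ext v
    simp [act, gact, smul_eq_C_mul]
  exact DFunLike.congr_fun h f

theorem mem_invSpace_iff {d : ℕ} {f : MvPolynomial Idx ℂ} :
    f ∈ invSpace 3 3 3 d ↔ f.IsHomogeneous d ∧
      ∀ A B C : Matrix (Fin 3) (Fin 3) ℂ, A.det = 1 → B.det = 1 → C.det = 1 →
        ∀ x, eval (gact A B C x) f = eval x f := by
  simp only [invSpace, Submodule.mem_inf, mem_homogeneousSubmodule, Submodule.mem_iInf,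
    LinearMap.mem_eqLocus, AlgHom.toLinearMap_apply, LinearMap.id_apply]
  refine and_congr_right fun _ => ⟨fun h A B C hA hB hC x => ?_, fun h g => ?_⟩
  · have := congrArg (eval x) (h (⟨A, hA⟩, ⟨B, hB⟩, ⟨C, hC⟩))
    rwa [eval_act] at this
  · refine MvPolynomial.funext fun x => ?_
    rw [eval_act]
    exact h _ _ _ g.1.2 g.2.1.2 g.2.2.2 x

theorem gact_smul_left (t : ℂ) (A B C : Matrix (Fin 3) (Fin 3) ℂ) (x : Idx → ℂ) :
    gact (t • A) B C x = t • gact A B C x := by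
  ext v
  simp only [gact, Matrix.smul_apply, smul_eq_mul, Pi.smul_apply, Finset.mul_sum]
  exact Finset.sum_congr rfl fun _ _ => by ring

theorem gact_smul_mid (t : ℂ) (A B C : Matrix (Fin 3) (Fin 3) ℂ) (x : Idx → ℂ) :
    gact A (t • B) C x = t • gact A B C x := by
  ext v
  simp only [gact, Matrix.smul_apply, smul_eq_mul, Pi.smul_apply, Finset.mul_sum]
  exact Finset.sum_congr rfl fun _ _ => by ring

theorem gact_smul_right (t : ℂ) (A B C : Matrix (Fin 3) (Fin 3) ℂ) (x : Idx → ℂ) :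
    gact A B (t • C) x = t • gact A B C x := by
  ext v
  simp only [gact, Matrix.smul_apply, smul_eq_mul, Pi.smul_apply, Finset.mul_sum]
  exact Finset.sum_congr rfl fun _ _ => by ring

theorem eval_smul_of_isHomogeneous {σ : Type*} {d : ℕ} {f : MvPolynomial σ ℂ}
    (hf : f.IsHomogeneous d) (t : ℂ) (x : σ → ℂ) : eval (t • x) f = t ^ d * eval x f := by
  simp only [eval_eq, Finset.mul_sum]
  refine Finset.sum_congr rfl fun m hm => ?_
  have hd : ∑ i ∈ m.support, m i = d := by
    rw [← hf (mem_support_iff.mp hm), Finsupp.weight_apply]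
    simp [Finsupp.sum]
  simp only [Pi.smul_apply, smul_eq_mul, mul_pow, Finset.prod_mul_distrib, Finset.prod_pow_eq_pow_sum, hd]
  ring

theorem eval_gact_of_pow_eq_det {d : ℕ} {f : MvPolynomial Idx ℂ} (hf : f ∈ invSpace 3 3 3 d)
    {A B C : Matrix (Fin 3) (Fin 3) ℂ} {a b c : ℂ} (ha : a ^ 3 = A.det) (hb : b ^ 3 = B.det)
    (hc : c ^ 3 = C.det) (ha0 : a ≠ 0) (hb0 : b ≠ 0) (hc0 : c ≠ 0) (x : Idx → ℂ) :
    eval (gact A B C x) f = (a * b * c) ^ d * eval x f := by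
  have key (M : Matrix (Fin 3) (Fin 3) ℂ) (m : ℂ) (hm : m ^ 3 = M.det) (hm0 : m ≠ 0) :
      ∃ N : Matrix (Fin 3) (Fin 3) ℂ, N.det = 1 ∧ M = m • N := by
    refine ⟨m⁻¹ • M, ?_, ?_⟩
    · rw [Matrix.det_smul, ← hm, Fintype.card_fin, ← mul_pow, inv_mul_cancel₀ hm0, one_pow]
    · rw [smul_smul, mul_inv_cancel₀ hm0, one_smul]
  obtain ⟨A', hA', rfl⟩ := key A a ha ha0
  obtain ⟨B', hB', rfl⟩ := key B b hb hb0
  obtain ⟨C', hC', rfl⟩ := key C c hc hc0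
  obtain ⟨hd, hi⟩ := mem_invSpace_iff.mp hf
  rw [gact_smul_left, gact_smul_mid, gact_smul_right, smul_smul, smul_smul,
    eval_smul_of_isHomogeneous hd, hi _ _ _ hA' hB' hC']

/-- The zero locus of an invariant is stable under triples of invertible matrices. -/
theorem eval_gact_eq_zero {d : ℕ} {f : MvPolynomial Idx ℂ} (hf : f ∈ invSpace 3 3 3 d)
    {A B C : Matrix (Fin 3) (Fin 3) ℂ} (hA : A.det ≠ 0) (hB : B.det ≠ 0) (hC : C.det ≠ 0)
    {x : Idx → ℂ} (hx : eval x f = 0) : eval (gact A B C x) f = 0 := by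
  obtain ⟨a, ha⟩ := IsAlgClosed.exists_pow_nat_eq A.det (n := 3) (by norm_num)
  obtain ⟨b, hb⟩ := IsAlgClosed.exists_pow_nat_eq B.det (n := 3) (by norm_num)
  obtain ⟨c, hc⟩ := IsAlgClosed.exists_pow_nat_eq C.det (n := 3) (by norm_num)
  rw [eval_gact_of_pow_eq_det hf ha hb hc (by rintro rfl; simp [← ha] at hA)
    (by rintro rfl; simp [← hb] at hB) (by rintro rfl; simp [← hc] at hC), hx, mul_zero]

/-- Invariants are fixed by all triples of matrices whose determinants multiply to one. -/
theorem eval_gact_of_det_mul_eq_one {d : ℕ} {f : MvPolynomial Idx ℂ} (hf : f ∈ invSpace 3 3 3 d)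
    {A B C : Matrix (Fin 3) (Fin 3) ℂ} (h : A.det * B.det * C.det = 1) (x : Idx → ℂ) :
    eval (gact A B C x) f = eval x f := by
  obtain ⟨a, ha⟩ := IsAlgClosed.exists_pow_nat_eq A.det (n := 3) (by norm_num)
  obtain ⟨b, hb⟩ := IsAlgClosed.exists_pow_nat_eq B.det (n := 3) (by norm_num)
  have ha0 : a ≠ 0 := by rintro rfl; simp [← ha] at h
  have hb0 : b ≠ 0 := by rintro rfl; simp [← hb] at h
  have hc : (a * b)⁻¹ ^ 3 = C.det := by
    rw [inv_pow, mul_pow, ha, hb]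
    exact inv_eq_of_mul_eq_one_right h
  rw [eval_gact_of_pow_eq_det hf ha hb hc ha0 hb0 (by simp [ha0, hb0]),
    mul_inv_cancel₀ (mul_ne_zero ha0 hb0), one_pow, one_mul]

/-- The parametrisation of the Cartan subspace spanned by the three tensors
`∑ i, e_i ⊗ e_{i+s} ⊗ e_{i+2s}`. -/
def cartan (u : Fin 3 → ℂ) : Idx → ℂ := fun v =>
  if v.1 + v.2.1 + v.2.2 = 0 then u (v.2.1 - v.1) else 0

/-- Restriction of polynomials to the Cartan subspace. -/
def res : MvPolynomial Idx ℂ →ₐ[ℂ] MvPolynomial (Fin 3) ℂ :=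
  aeval fun v => if v.1 + v.2.1 + v.2.2 = 0 then X (v.2.1 - v.1) else 0

theorem eval_res (f : MvPolynomial Idx ℂ) (u : Fin 3 → ℂ) :
    eval u (res f) = eval (cartan u) f := by
  have h : ((aeval u).comp res : MvPolynomial Idx ℂ →ₐ[ℂ] ℂ) = aeval (cartan u) := by
    ext v
    simp only [res, AlgHom.comp_apply, aeval_X, cartan]
    split_ifs <;> simp
  exact DFunLike.congr_fun h f

/-- Homogeneous polynomials of degree `d` on the Cartan subspace that are invariant under a
generating set of the complex reflection group `G₂₅`, with respect to the primitive cube root of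
unity `ω`. -/
def weylInv (ω : ℂ) (d : ℕ) : Submodule ℂ (MvPolynomial (Fin 3) ℂ) where
  carrier := {F | F.IsHomogeneous d ∧
    (∀ a b c, eval ![ω * a, b, c] F = eval ![a, b, c] F) ∧
    (∀ a b c, eval ![b, c, a] F = eval ![a, b, c] F) ∧
    ∀ a b c, eval (((1 + 2 * ω) / 3) • ![a + b + c, a + ω ^ 2 * b + ω * c, a + ω * b + ω ^ 2 * c]) F =
      eval ![a, b, c] F}
  add_mem' := by
    rintro F G ⟨h1, h2, h3, h4⟩ ⟨k1, k2, k3, k4⟩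
    exact ⟨h1.add k1, fun a b c => by rw [map_add, map_add, h2, k2],
      fun a b c => by rw [map_add, map_add, h3, k3], fun a b c => by rw [map_add, map_add, h4, k4]⟩
  zero_mem' := ⟨isHomogeneous_zero _ _ _, fun _ _ _ => by rw [map_zero, map_zero],
    fun _ _ _ => by rw [map_zero, map_zero], fun _ _ _ => by rw [map_zero, map_zero]⟩
  smul_mem' := by
    rintro t F ⟨h1, h2, h3, h4⟩
    refine ⟨(homogeneousSubmodule _ ℂ d).smul_mem t h1, fun a b c => by rw [smul_eval, smul_eval, h2],
      fun a b c => by rw [smul_eval, smul_eval, h3], fun a b c => by rw [smul_eval, smul_eval, h4]⟩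

theorem gact_diagonal_cartan {ω : ℂ} (h : ω ^ 2 + ω + 1 = 0) (a b c : ℂ) :
    gact (Matrix.diagonal ![ω, ω, 1]) (Matrix.diagonal ![1, 1, ω ^ 2])
      (Matrix.diagonal ![1, 1, ω ^ 2]) (cartan ![a, b, c]) = cartan ![ω * a, b, c] := by
  have h3 : ω ^ 3 = 1 := by linear_combination (ω - 1) * h
  have e4 : ω ^ 2 * ω ^ 2 = ω := by linear_combination ω * h3
  funext v
  obtain ⟨i, j, k⟩ := v
  have : gact (Matrix.diagonal ![ω, ω, 1]) (Matrix.diagonal ![1, 1, ω ^ 2])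
      (Matrix.diagonal ![1, 1, ω ^ 2]) (cartan ![a, b, c]) (i, j, k) =
      (![ω, ω, 1] i * ![1, 1, ω ^ 2] j * ![1, 1, ω ^ 2] k) * cartan ![a, b, c] (i, j, k) := by
    rw [gact, Finset.sum_eq_single (i, j, k)]
    · simp
    · rintro ⟨i', j', k'⟩ - hne
      simp only [Matrix.diagonal_apply]
      split_ifs <;> simp_all
    · simp
  rw [this]
  fin_cases i <;> fin_cases j <;> fin_cases k <;> simp [cartan]
  all_goals grind

theorem gact_shift_cartan (a b c : ℂ) :
    gact 1 !![0, 0, 1; 1, 0, 0; 0, 1, 0] !![0, 1, 0; 0, 0, 1; 1, 0, 0] (cartan ![a, b, c]) =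
      cartan ![b, c, a] := by
  funext v
  obtain ⟨i, j, k⟩ := v
  simp only [gact, Fintype.sum_prod_type, Fin.sum_univ_three]
  fin_cases i <;> fin_cases j <;> fin_cases k <;> simp [cartan, Matrix.one_apply]

theorem gact_fourier_cartan {ω : ℂ} (h : ω ^ 2 + ω + 1 = 0) (a b c : ℂ) :
    gact (((1 + 2 * ω) / 9) • !![1, 1, 1; 1, ω, ω ^ 2; 1, ω ^ 2, ω]) !![1, 1, 1; 1, ω, ω ^ 2; 1, ω ^ 2, ω]
      !![1, 1, 1; 1, ω, ω ^ 2; 1, ω ^ 2, ω] (cartan ![a, b, c]) =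
      cartan (((1 + 2 * ω) / 3) • ![a + b + c, a + ω ^ 2 * b + ω * c, a + ω * b + ω ^ 2 * c]) := by
  rw [gact_smul_left]
  funext v
  obtain ⟨i, j, k⟩ := v
  simp only [Pi.smul_apply, gact, Fintype.sum_prod_type, Fin.sum_univ_three]
  fin_cases i <;> fin_cases j <;> fin_cases k <;> simp only [cartan]
  all_goals simp
  all_goals grind

theorem res_mem_weylInv {ω : ℂ} (h : ω ^ 2 + ω + 1 = 0) {d : ℕ} {f : MvPolynomial Idx ℂ}
    (hf : f ∈ invSpace 3 3 3 d) : res f ∈ weylInv ω d := by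
  have h3 : ω ^ 3 = 1 := by linear_combination (ω - 1) * h
  refine ⟨?_, fun a b c => ?_, fun a b c => ?_, fun a b c => ?_⟩
  · have := (mem_invSpace_iff.mp hf).1.aeval
      (fun v : Idx => if v.1 + v.2.1 + v.2.2 = 0 then (X (v.2.1 - v.1) : MvPolynomial (Fin 3) ℂ)
        else 0) (n := 1) fun v => by
        split_ifs
        exacts [isHomogeneous_X _ _, isHomogeneous_zero _ _ _]
    rwa [one_mul] at this
  · rw [eval_res, eval_res, ← gact_diagonal_cartan h, eval_gact_of_det_mul_eq_one hf]
    simp only [Matrix.det_diagonal, Fin.prod_univ_three]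
    simp
    grind
  · rw [eval_res, eval_res, ← gact_shift_cartan, eval_gact_of_det_mul_eq_one hf]
    simp [Matrix.det_fin_three]
  · rw [eval_res, eval_res, ← gact_fourier_cartan h, eval_gact_of_det_mul_eq_one hf]
    simp [Matrix.det_fin_three]
    grind

/-- The action map of triples of matrices on the Cartan subspace. -/
def orbitMap (p : (Fin 3 → Fin 3 → ℂ) × (Fin 3 → Fin 3 → ℂ) × (Fin 3 → Fin 3 → ℂ) × (Fin 3 → ℂ)) :
    Idx → ℂ :=
  gact p.1 p.2.1 p.2.2.1 (cartan p.2.2.2)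

theorem contDiff_orbitMap : ContDiff ℂ 1 orbitMap := by
  unfold orbitMap gact cartan
  refine contDiff_pi.mpr fun v => ContDiff.sum fun w _ => ?_
  refine ContDiff.mul (by fun_prop) ?_
  split_ifs <;> fun_prop

/-- The identity triple together with a point off the reflection hyperplanes. -/
def basePoint :
    (Fin 3 → Fin 3 → ℂ) × (Fin 3 → Fin 3 → ℂ) × (Fin 3 → Fin 3 → ℂ) × (Fin 3 → ℂ) :=
  ((1 : Matrix (Fin 3) (Fin 3) ℂ), (1 : Matrix (Fin 3) (Fin 3) ℂ), (1 : Matrix (Fin 3) (Fin 3) ℂ),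
    ![1, 1, -1])

theorem fderiv_apply_of_line {E F : Type*} [NormedAddCommGroup E] [NormedSpace ℂ E]
    [NormedAddCommGroup F] [NormedSpace ℂ F] {φ : E → F} {φ' : E →L[ℂ] F} {p w : E} {y : F}
    (hφ : HasFDerivAt φ φ' p) (h : ∀ t : ℂ, φ (p + t • w) = φ p + t • y) : φ' w = y := by
  have h1 : HasDerivAt (fun t : ℂ => p + t • w) w 0 := by
    simpa using ((hasDerivAt_id (0 : ℂ)).smul_const w).const_add p
  have h2 : HasDerivAt (fun t : ℂ => φ (p + t • w)) (φ' w) 0 := by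
    refine HasFDerivAt.comp_hasDerivAt (x := (0 : ℂ)) (f := fun t : ℂ => p + t • w) ?_ h1
    simpa using hφ
  have h3 : HasDerivAt (fun t : ℂ => φ (p + t • w)) y 0 := by
    simp only [h]
    simpa using ((hasDerivAt_id (0 : ℂ)).smul_const y).const_add (φ p)
  exact h2.unique h3

/-- The tangent directions of the orbit map at the base point span the space of tensors. -/
theorem eq_zero_of_tangent {y : Idx → ℂ} {x : Idx → ℂ} (hx : x = cartan ![1, 1, -1])
    (h1 : ∀ p q, ∑ j, ∑ k, x (p, j, k) * y (q, j, k) = 0)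
    (h2 : ∀ p q, ∑ i, ∑ k, x (i, p, k) * y (i, q, k) = 0)
    (h3 : ∀ p q, ∑ i, ∑ j, x (i, j, p) * y (i, j, q) = 0)
    (h4 : ∀ u, ∑ v, cartan u v * y v = 0) : y = 0 := by
  have h40 := h4 ![1, 0, 0]
  have h41 := h4 ![0, 1, 0]
  have h42 := h4 ![0, 0, 1]
  clear h4
  subst hx
  simp [Fin.forall_fin_succ, Fin.sum_univ_three, cartan, Fintype.sum_prod_type] at h1 h2 h3 h40 h41 h42
  funext ⟨i, j, k⟩
  fin_cases i <;> fin_cases j <;> fin_cases k <;> simp only [Fin.zero_eta, Fin.mk_one, Fin.reduceFinMk, Pi.zero_apply] <;> grind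

theorem gact_add_smul_left (t : ℂ) (A A' B C : Matrix (Fin 3) (Fin 3) ℂ) (x : Idx → ℂ) :
    gact (A + t • A') B C x = gact A B C x + t • gact A' B C x := by
  ext v
  simp only [gact, Matrix.add_apply, Matrix.smul_apply, smul_eq_mul, Pi.smul_apply, Pi.add_apply,
    Finset.mul_sum, ← Finset.sum_add_distrib]
  exact Finset.sum_congr rfl fun _ _ => by ring

theorem gact_add_smul_mid (t : ℂ) (A B B' C : Matrix (Fin 3) (Fin 3) ℂ) (x : Idx → ℂ) :
    gact A (B + t • B') C x = gact A B C x + t • gact A B' C x := by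
  ext v
  simp only [gact, Matrix.add_apply, Matrix.smul_apply, smul_eq_mul, Pi.smul_apply, Pi.add_apply,
    Finset.mul_sum, ← Finset.sum_add_distrib]
  exact Finset.sum_congr rfl fun _ _ => by ring

theorem gact_add_smul_right (t : ℂ) (A B C C' : Matrix (Fin 3) (Fin 3) ℂ) (x : Idx → ℂ) :
    gact A B (C + t • C') x = gact A B C x + t • gact A B C' x := by
  ext v
  simp only [gact, Matrix.add_apply, Matrix.smul_apply, smul_eq_mul, Pi.smul_apply, Pi.add_apply,
    Finset.mul_sum, ← Finset.sum_add_distrib]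
  exact Finset.sum_congr rfl fun _ _ => by ring

theorem gact_one (x : Idx → ℂ) : gact 1 1 1 x = x := by
  funext v
  rw [gact, Finset.sum_eq_single v]
  · simp
  · rintro ⟨i, j, k⟩ - hne
    simp only [Matrix.one_apply]
    split_ifs <;> simp_all
  · simp

theorem cartan_add_smul (t : ℂ) (u w : Fin 3 → ℂ) :
    cartan (u + t • w) = cartan u + t • cartan w := by
  funext v
  simp only [cartan, Pi.add_apply, Pi.smul_apply, smul_eq_mul]
  split_ifs <;> simp

theorem sum_gact_single_left (p q : Fin 3) (x y : Idx → ℂ) :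
    ∑ v, gact (Matrix.single p q 1) 1 1 x v * y v = ∑ j, ∑ k, x (p, j, k) * y (q, j, k) := by
  simp only [gact, Fintype.sum_prod_type, Matrix.single_apply, Matrix.one_apply, ite_and]
  simp

theorem sum_gact_single_mid (p q : Fin 3) (x y : Idx → ℂ) :
    ∑ v, gact 1 (Matrix.single p q 1) 1 x v * y v = ∑ i, ∑ k, x (i, p, k) * y (i, q, k) := by
  simp only [gact, Fintype.sum_prod_type, Matrix.single_apply, Matrix.one_apply, ite_and]
  simp

theorem sum_gact_single_right (p q : Fin 3) (x y : Idx → ℂ) :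
    ∑ v, gact 1 1 (Matrix.single p q 1) x v * y v = ∑ i, ∑ j, x (i, j, p) * y (i, j, q) := by
  simp only [gact, Fintype.sum_prod_type, Matrix.single_apply, Matrix.one_apply, ite_and]
  simp

/-- The tangent vector at the base point with the given components. -/
def tangentVector (A B C : Matrix (Fin 3) (Fin 3) ℂ) (u : Fin 3 → ℂ) :
    (Fin 3 → Fin 3 → ℂ) × (Fin 3 → Fin 3 → ℂ) × (Fin 3 → Fin 3 → ℂ) × (Fin 3 → ℂ) :=
  (A, B, C, u)

theorem orbitMap_basePoint_add_smul (t : ℂ) (A B C : Matrix (Fin 3) (Fin 3) ℂ) (u : Fin 3 → ℂ) :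
    orbitMap (basePoint + t • tangentVector A B C u) =
      gact (1 + t • A) (1 + t • B) (1 + t • C) (cartan (![1, 1, -1] + t • u)) :=
  rfl

theorem orbitMap_basePoint : orbitMap basePoint = gact 1 1 1 (cartan ![1, 1, -1]) :=
  rfl

theorem range_fderiv_orbitMap {φ' : (Fin 3 → Fin 3 → ℂ) × (Fin 3 → Fin 3 → ℂ) ×
      (Fin 3 → Fin 3 → ℂ) × (Fin 3 → ℂ) →L[ℂ] (Idx → ℂ)}
    (hφ : HasFDerivAt orbitMap φ' basePoint) : φ'.range = ⊤ := by
  by_contra hne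
  obtain ⟨ψ, hψ, hle⟩ := Submodule.exists_le_ker_of_lt_top _ (lt_top_iff_ne_top.mpr hne)
  obtain ⟨y, hy⟩ : ∃ y : Idx → ℂ, ∀ x, ψ x = ∑ v, x v * y v := by
    refine ⟨fun v => ψ (Pi.single v 1), fun x => ?_⟩
    rw [LinearMap.pi_apply_eq_sum_univ ψ x]
    refine Finset.sum_congr rfl fun v _ => ?_
    rw [smul_eq_mul]
    congr 2
    funext w
    simp [Pi.single_apply, eq_comm]
  have hzero (A B C : Matrix (Fin 3) (Fin 3) ℂ) (u : Fin 3 → ℂ) (z : Idx → ℂ)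
      (h : ∀ t : ℂ, gact (1 + t • A) (1 + t • B) (1 + t • C) (cartan (![1, 1, -1] + t • u)) =
        gact 1 1 1 (cartan ![1, 1, -1]) + t • z) : ∑ v, z v * y v = 0 := by
    have := fderiv_apply_of_line (w := tangentVector A B C u) hφ (y := z) fun t => by
      rw [orbitMap_basePoint_add_smul, orbitMap_basePoint, h]
    rw [← hy, ← this]
    exact hle ⟨_, rfl⟩
  have hy0 : y = 0 := by
    refine eq_zero_of_tangent rfl (fun p q => ?_) (fun p q => ?_) (fun p q => ?_) (fun u => ?_)
    · rw [← sum_gact_single_left]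
      refine hzero (Matrix.single p q 1) 0 0 0 _ fun t => ?_
      simp only [smul_zero, add_zero, gact_add_smul_left]
    · rw [← sum_gact_single_mid]
      refine hzero 0 (Matrix.single p q 1) 0 0 _ fun t => ?_
      simp only [smul_zero, add_zero, gact_add_smul_mid]
    · rw [← sum_gact_single_right]
      refine hzero 0 0 (Matrix.single p q 1) 0 _ fun t => ?_
      simp only [smul_zero, add_zero, gact_add_smul_right]
    · refine hzero 0 0 0 u _ fun t => ?_
      simp only [smul_zero, add_zero, gact_one, cartan_add_smul]
  refine hψ (LinearMap.ext fun x => ?_)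
  simp [hy, hy0]

theorem eq_zero_of_eventually_eval_eq_zero {σ : Type*} [Finite σ] {f : MvPolynomial σ ℂ}
    {a : σ → ℂ} (h : ∀ᶠ x in nhds a, eval x f = 0) : f = 0 := by
  have := Fintype.ofFinite σ
  obtain ⟨ε, hε, hb⟩ := Metric.eventually_nhds_iff_ball.mp h
  refine funext_set (fun i => Metric.ball (a i) ε) (fun i => ?_) fun x hx => ?_
  · exact infinite_of_mem_nhds (a i) (Metric.ball_mem_nhds _ hε)
  · rw [map_zero]
    refine hb x ?_
    rw [ball_pi _ hε]
    exact hx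

/-- An invariant is determined by its restriction to the Cartan subspace. -/
theorem eq_zero_of_res_eq_zero {d : ℕ} {f : MvPolynomial Idx ℂ} (hf : f ∈ invSpace 3 3 3 d)
    (h : res f = 0) : f = 0 := by
  have hs := contDiff_orbitMap.contDiffAt.hasStrictFDerivAt (x := basePoint) (by norm_num)
  have hmap := hs.map_nhds_eq_of_surj (range_fderiv_orbitMap hs.hasFDerivAt)
  refine eq_zero_of_eventually_eval_eq_zero (a := orbitMap basePoint) ?_
  rw [← hmap, Filter.eventually_map]
  have hdet (g : (Fin 3 → Fin 3 → ℂ) × (Fin 3 → Fin 3 → ℂ) × (Fin 3 → Fin 3 → ℂ) × (Fin 3 → ℂ) →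
      Matrix (Fin 3) (Fin 3) ℂ) (hg : Continuous g) (h1 : g basePoint = 1) :
      ∀ᶠ p in nhds basePoint, (g p).det ≠ 0 :=
    hg.matrix_det.continuousAt.eventually_ne (by simp [h1])
  filter_upwards [hdet (fun p => p.1) (by fun_prop) rfl, hdet (fun p => p.2.1) (by fun_prop) rfl,
    hdet (fun p => p.2.2.1) (by fun_prop) rfl] with p hA hB hC
  exact eval_gact_eq_zero hf hA hB hC (by rw [← eval_res, h, map_zero])

open Matrix in
/-- Contraction of a tensor in `A ⊗ B ⊗ C` with `A* ⊗ B`, followed by the cross product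
`B ⊗ B → B*`, as a linear map `A* ⊗ B → B* ⊗ C`. -/
def contract {R : Type*} [CommRing R] (T : Fin 3 → Fin 3 → Fin 3 → R) :
    Matrix (Fin 3 × Fin 3) (Fin 3 × Fin 3) R :=
  of fun r s => if r.1 = s.2 + 1 then T s.1 (s.2 + 2) r.2
    else if r.1 = s.2 + 2 then -T s.1 (s.2 + 1) r.2 else 0

/-- The endomorphism of `A* ⊗ B` obtained by composing the three cyclic contractions of a tensor. -/
def loop {R : Type*} [CommRing R] (T : Fin 3 → Fin 3 → Fin 3 → R) :
    Matrix (Fin 3 × Fin 3) (Fin 3 × Fin 3) R :=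
  contract (fun k i j => T i j k) * contract (fun j k i => T i j k) * contract T

section Covariance

open Matrix Kronecker

variable {R : Type*} [CommRing R] (T : Fin 3 → Fin 3 → Fin 3 → R) (g h l : Matrix (Fin 3) (Fin 3) R)

theorem contract_left :
    contract (fun i j k => ∑ i', g i i' * T i' j k) =
      contract T * (gᵀ ⊗ₖ (1 : Matrix (Fin 3) (Fin 3) R)) := by
  ext ⟨p, k⟩ ⟨i, j⟩
  simp only [contract, mul_apply, kroneckerMap_apply, of_apply, Fintype.sum_prod_type,
    transpose_apply, one_apply]
  simp only [mul_ite, mul_one, mul_zero, Finset.sum_ite_eq', Finset.mem_univ, if_true]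
  split_ifs <;> simp [mul_comm]

theorem contract_right :
    contract (fun i j k => ∑ k', l k k' * T i j k') =
      ((1 : Matrix (Fin 3) (Fin 3) R) ⊗ₖ l) * contract T := by
  ext ⟨p, k⟩ ⟨i, j⟩
  have e : (((1 : Matrix (Fin 3) (Fin 3) R) ⊗ₖ l) * contract T) (p, k) (i, j) =
      ∑ m, l k m * contract T (p, m) (i, j) := by
    rw [mul_apply, Fintype.sum_prod_type,
      Finset.sum_eq_single p (fun b _ hb => by simp [hb.symm]) (by simp)]
    simp
  rw [e]
  simp only [contract, of_apply]
  split_ifs <;> simp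

theorem contract_mid :
    contract (fun i j k => ∑ j', h j j' * T i j' k) * ((1 : Matrix (Fin 3) (Fin 3) R) ⊗ₖ h) =
      ((adjugate h)ᵀ ⊗ₖ (1 : Matrix (Fin 3) (Fin 3) R)) * contract T := by
  ext ⟨p, k⟩ ⟨i, j⟩
  have e1 : (contract (fun i j k => ∑ j', h j j' * T i j' k) *
      ((1 : Matrix (Fin 3) (Fin 3) R) ⊗ₖ h)) (p, k) (i, j) =
      ∑ m, contract (fun i j k => ∑ j', h j j' * T i j' k) (p, k) (i, m) * h m j := by
    rw [mul_apply, Fintype.sum_prod_type,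
      Finset.sum_eq_single i (fun b _ hb => by simp [hb]) (by simp)]
    simp
  have e2 : (((adjugate h)ᵀ ⊗ₖ (1 : Matrix (Fin 3) (Fin 3) R)) * contract T) (p, k) (i, j) =
      ∑ m, adjugate h m p * contract T (m, k) (i, j) := by
    rw [mul_apply, Fintype.sum_prod_type]
    refine Finset.sum_congr rfl fun m _ => ?_
    rw [Finset.sum_eq_single k (fun b _ hb => by simp [hb.symm]) (by simp)]
    simp
  rw [e1, e2]
  simp only [Fin.sum_univ_three, contract, of_apply, adjugate_fin_three]
  fin_cases p <;> fin_cases j <;> simp <;> ring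

theorem contract_act (hg : g.det = 1) :
    contract (fun i j k => ∑ i', g i i' * ∑ j', h j j' * ∑ k', l k k' * T i' j' k') *
        ((adjugate g)ᵀ ⊗ₖ h) =
      ((adjugate h)ᵀ ⊗ₖ l) * contract T := by
  have hg' : gᵀ * (adjugate g)ᵀ = 1 := by
    rw [← transpose_mul, adjugate_mul, hg, one_smul, transpose_one]
  have e1 : (adjugate g)ᵀ ⊗ₖ h = ((adjugate g)ᵀ ⊗ₖ 1) * (1 ⊗ₖ h) := by
    rw [← mul_kronecker_mul, one_mul, mul_one]
  rw [contract_left (fun i j k => ∑ j', h j j' * ∑ k', l k k' * T i j' k'), e1, Matrix.mul_assoc,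
    ← Matrix.mul_assoc (gᵀ ⊗ₖ 1), ← mul_kronecker_mul, hg', one_mul, one_kronecker_one,
    Matrix.one_mul, contract_mid (fun i j k => ∑ k', l k k' * T i j k'), contract_right,
    ← Matrix.mul_assoc, ← mul_kronecker_mul, one_mul, mul_one]

theorem loop_act (hg : g.det = 1) (hh : h.det = 1) (hl : l.det = 1) :
    loop (fun i j k => ∑ i', g i i' * ∑ j', h j j' * ∑ k', l k k' * T i' j' k') *
        ((adjugate g)ᵀ ⊗ₖ h) =
      ((adjugate g)ᵀ ⊗ₖ h) * loop T := by
  have e1 := contract_act T g h l hg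
  have e2 := contract_act (fun j k i => T i j k) h l g hh
  have e3 := contract_act (fun k i j => T i j k) l g h hl
  have c2 : (fun j k i => ∑ i', g i i' * ∑ j', h j j' * ∑ k', l k k' * T i' j' k') =
      fun j k i => ∑ j', h j j' * ∑ k', l k k' * ∑ i', g i i' * T i' j' k' := by
    funext j k i
    simp only [Fin.sum_univ_three]
    ring
  have c3 : (fun k i j => ∑ i', g i i' * ∑ j', h j j' * ∑ k', l k k' * T i' j' k') =
      fun k i j => ∑ k', l k k' * ∑ i', g i i' * ∑ j', h j j' * T i' j' k' := by
    funext k i j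
    simp only [Fin.sum_univ_three]
    ring
  rw [loop, loop, c2, c3, Matrix.mul_assoc, Matrix.mul_assoc, e1, ← Matrix.mul_assoc (contract _) _ (contract T), e2,
    Matrix.mul_assoc, ← Matrix.mul_assoc, e3, Matrix.mul_assoc, Matrix.mul_assoc]

theorem trace_loop_pow_act (hg : g.det = 1) (hh : h.det = 1) (hl : l.det = 1) (n : ℕ) :
    (loop (fun i j k => ∑ i', g i i' * ∑ j', h j j' * ∑ k', l k k' * T i' j' k') ^ n).trace =
      (loop T ^ n).trace := by
  have hg' : gᵀ * (adjugate g)ᵀ = 1 := by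
    rw [← transpose_mul, adjugate_mul, hg, one_smul, transpose_one]
  have hh' : adjugate h * h = 1 := by rw [adjugate_mul, hh, one_smul]
  have hP : (gᵀ ⊗ₖ adjugate h) * ((adjugate g)ᵀ ⊗ₖ h) = 1 := by
    rw [← mul_kronecker_mul, hg', hh', one_kronecker_one]
  have hs : SemiconjBy ((adjugate g)ᵀ ⊗ₖ h) (loop T)
      (loop (fun i j k => ∑ i', g i i' * ∑ j', h j j' * ∑ k', l k k' * T i' j' k')) :=
    (loop_act T g h l hg hh hl).symm
  have := (hs.pow_right n).eq
  have e : loop T ^ n = (gᵀ ⊗ₖ adjugate h) * (((adjugate g)ᵀ ⊗ₖ h) * loop T ^ n) := by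
    rw [← Matrix.mul_assoc, hP, Matrix.one_mul]
  rw [e, this, trace_mul_comm, Matrix.mul_assoc, mul_eq_one_comm.mp hP, Matrix.mul_one]

end Covariance

/-- The invariant polynomial `tr (loop T ^ n)` of a tensor `T`. -/
def traceInv (n : ℕ) : MvPolynomial Idx ℂ :=
  (loop (fun i j k => (X (i, j, k) : MvPolynomial Idx ℂ)) ^ n).trace

theorem map_contract {R S : Type*} [CommRing R] [CommRing S] (φ : R →+* S)
    (T : Fin 3 → Fin 3 → Fin 3 → R) :
    (contract T).map φ = contract fun i j k => φ (T i j k) := by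
  ext r s
  simp only [contract, Matrix.map_apply, Matrix.of_apply]
  split_ifs <;> simp

theorem map_loop {R S : Type*} [CommRing R] [CommRing S] (φ : R →+* S)
    (T : Fin 3 → Fin 3 → Fin 3 → R) :
    (loop T).map φ = loop fun i j k => φ (T i j k) := by
  simp only [loop, Matrix.map_mul, map_contract]

theorem map_trace_loop_pow {R S : Type*} [CommRing R] [CommRing S] (φ : R →+* S)
    (T : Fin 3 → Fin 3 → Fin 3 → R) (n : ℕ) :
    φ (loop T ^ n).trace = (loop (fun i j k => φ (T i j k)) ^ n).trace := by
  rw [← map_loop, ← RingHom.mapMatrix_apply, ← map_pow, RingHom.mapMatrix_apply,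
    AddMonoidHom.map_trace]

theorem eval_traceInv (n : ℕ) (x : Idx → ℂ) :
    eval x (traceInv n) = (loop (fun i j k => x (i, j, k)) ^ n).trace := by
  rw [traceInv, map_trace_loop_pow]
  simp only [eval_X]

theorem isHomogeneous_mul_apply {ι : Type*} [Fintype ι] {σ : Type*} {m n : ℕ}
    {M N : Matrix ι ι (MvPolynomial σ ℂ)} (hM : ∀ i j, (M i j).IsHomogeneous m)
    (hN : ∀ i j, (N i j).IsHomogeneous n) (i j : ι) : ((M * N) i j).IsHomogeneous (m + n) := by
  rw [Matrix.mul_apply]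
  exact IsHomogeneous.sum _ _ _ fun k _ => (hM i k).mul (hN k j)

theorem isHomogeneous_contract {σ : Type*} {m : ℕ} {T : Fin 3 → Fin 3 → Fin 3 → MvPolynomial σ ℂ}
    (h : ∀ i j k, (T i j k).IsHomogeneous m) (r s : Fin 3 × Fin 3) :
    (contract T r s).IsHomogeneous m := by
  simp only [contract, Matrix.of_apply]
  split_ifs
  exacts [h _ _ _, (h _ _ _).neg, isHomogeneous_zero _ _ _]

theorem isHomogeneous_traceInv (n : ℕ) : (traceInv n).IsHomogeneous (3 * n) := by
  have h : ∀ r s, (loop (fun i j k => (X (i, j, k) : MvPolynomial Idx ℂ)) r s).IsHomogeneous 3 :=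
    isHomogeneous_mul_apply (isHomogeneous_mul_apply
      (isHomogeneous_contract fun _ _ _ => isHomogeneous_X _ _)
      (isHomogeneous_contract fun _ _ _ => isHomogeneous_X _ _))
      (isHomogeneous_contract fun _ _ _ => isHomogeneous_X _ _)
  have hp : ∀ r s, ((loop (fun i j k => (X (i, j, k) : MvPolynomial Idx ℂ)) ^ n)
      r s).IsHomogeneous (3 * n) := by
    induction n with
    | zero =>
      intro r s
      rw [pow_zero, Matrix.one_apply]
      split_ifs
      exacts [isHomogeneous_one _ _, isHomogeneous_zero _ _ _]
    | succ n ih =>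
      rw [pow_succ]
      exact isHomogeneous_mul_apply ih h
  exact IsHomogeneous.sum _ _ _ fun r _ => hp r r

theorem traceInv_mem_invSpace (n : ℕ) : traceInv n ∈ invSpace 3 3 3 (3 * n) := by
  refine mem_invSpace_iff.mpr ⟨isHomogeneous_traceInv n, fun A B C hA hB hC x => ?_⟩
  rw [eval_traceInv, eval_traceInv, ← trace_loop_pow_act (fun i j k => x (i, j, k)) A.transpose
    B.transpose C.transpose
    (by rwa [Matrix.det_transpose]) (by rwa [Matrix.det_transpose])
    (by rwa [Matrix.det_transpose])]
  congr
  funext i j k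
  simp only [gact, Fintype.sum_prod_type, Matrix.transpose_apply, Finset.mul_sum]
  exact Finset.sum_congr rfl fun _ _ => Finset.sum_congr rfl fun _ _ =>
    Finset.sum_congr rfl fun _ _ => by ring

/-- The integral points of the Cartan subspace. -/
def intCartan (u : Fin 3 → ℤ) (i j k : Fin 3) : ℤ := if i + j + k = 0 then u (j - i) else 0

theorem eval_res_traceInv (n : ℕ) (u : Fin 3 → ℤ) :
    eval (fun i => (u i : ℂ)) (res (traceInv n)) = ((loop (intCartan u) ^ n).trace : ℤ) := by
  have e : (fun i j k => cartan (fun i => (u i : ℂ)) (i, j, k)) =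
      fun i j k => Int.castRingHom ℂ (intCartan u i j k) := by
    funext i j k
    simp only [cartan, intCartan]
    split_ifs <;> simp
  rw [eval_res, eval_traceInv, e, ← map_trace_loop_pow]
  rfl

theorem trace_loop_values :
    (loop (intCartan ![1, 0, 0]) ^ 2).trace = 6 ∧ (loop (intCartan ![1, 0, 0]) ^ 4).trace = 6 ∧
    (loop (intCartan ![0, 1, 1]) ^ 2).trace = -48 ∧
    (loop (intCartan ![0, 1, 1]) ^ 4).trace = 1464 ∧
    (loop (intCartan ![0, 1, -1]) ^ 3).trace = -504 := by
  refine ⟨?_, ?_, ?_, ?_, ?_⟩ <;> decide +kernel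

section LinearForms

variable {σ : Type*} {i j : σ}

theorem eval_aeval_apply {τ : Type*} (L : σ → MvPolynomial τ ℂ) (p : MvPolynomial σ ℂ) (u : τ → ℂ) :
    eval u (aeval L p) = eval (fun s => eval u (L s)) p := by
  have h : ((aeval u).comp (aeval L) : MvPolynomial σ ℂ →ₐ[ℂ] ℂ) =
      aeval fun s => eval u (L s) := by
    ext s
    simp
  exact DFunLike.congr_fun h p

theorem linear_dvd_of_eval_eq_zero (hij : i ≠ j) (t : ℂ) {p : MvPolynomial σ ℂ}
    (hp : ∀ u : σ → ℂ, u i = t * u j → eval u p = 0) : (X i - C t * X j) ∣ p := by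
  classical
  set φ : MvPolynomial σ ℂ →ₐ[ℂ] MvPolynomial σ ℂ :=
    aeval (Function.update X i (C t * X j)) with hφ
  have h0 : φ p = 0 := by
    refine MvPolynomial.funext fun u => ?_
    rw [hφ, eval_aeval_apply, map_zero]
    apply hp
    simp [Function.update_of_ne hij.symm]
  have hq : (Ideal.Quotient.mkₐ ℂ (Ideal.span {X i - C t * X j})).comp φ =
      Ideal.Quotient.mkₐ ℂ (Ideal.span {X i - C t * X j}) := by
    ext s
    rw [AlgHom.comp_apply, hφ, aeval_X]
    by_cases hs : s = i
    · subst hs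
      rw [Function.update_self, Ideal.Quotient.mkₐ_eq_mk, Ideal.Quotient.eq,
        Ideal.mem_span_singleton, ← dvd_neg, neg_sub]
    · rw [Function.update_of_ne hs]
  have := DFunLike.congr_fun hq p
  rw [AlgHom.comp_apply, h0, map_zero, Ideal.Quotient.mkₐ_eq_mk] at this
  exact Ideal.mem_span_singleton.mp (Ideal.Quotient.eq_zero_iff_mem.mp this.symm)

theorem prime_linear (hij : i ≠ j) (t : ℂ) : Prime (X i - C t * X j : MvPolynomial σ ℂ) := by
  classical
  have hdvd {p : MvPolynomial σ ℂ} : (X i - C t * X j) ∣ p ↔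
      aeval (Function.update X i (C t * X j)) p = (0 : MvPolynomial σ ℂ) := by
    constructor
    · rintro ⟨q, rfl⟩
      simp [Function.update_of_ne hij.symm, ← algebraMap_eq]
    · refine fun h => linear_dvd_of_eval_eq_zero hij t fun u hu => ?_
      have := congrArg (eval u) h
      rw [eval_aeval_apply, map_zero] at this
      have e : (fun s => eval u (Function.update X i (C t * X j) s)) = u := by
        funext s
        by_cases hs : s = i
        · subst hs
          simp [hu]
        · simp [Function.update_of_ne hs]
      rwa [e] at this
  refine ⟨fun h => ?_, fun h => ?_, fun p q h => ?_⟩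
  · have := congrArg (eval (Pi.single i 1)) h
    simp [hij.symm] at this
  · have := hdvd.mp (h.dvd (a := 1))
    simp at this
  · simpa only [hdvd, map_mul, mul_eq_zero] using h

theorem linear_mul_dvd (hij : i ≠ j) (t : ℂ) {p M : MvPolynomial σ ℂ} (hM : M ∣ p)
    (hp : ∀ u : σ → ℂ, u i = t * u j → eval u p = 0) {u : σ → ℂ} (hu : u i = t * u j)
    (hMu : eval u M ≠ 0) : (X i - C t * X j) * M ∣ p := by
  obtain ⟨q, rfl⟩ := hM
  rcases (prime_linear hij t).dvd_or_dvd (linear_dvd_of_eval_eq_zero hij t hp) with ⟨r, rfl⟩ | h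
  · simp [hu] at hMu
  · rw [mul_comm M q]
    exact mul_dvd_mul_right h M

theorem cubic_mul_dvd {ω : ℂ} (h : ω ^ 2 + ω + 1 = 0) (hij : i ≠ j) {s : ℂ} (hs : s ≠ 0)
    {p M : MvPolynomial σ ℂ} (hM : M ∣ p)
    (hp : ∀ (k : ℕ) (u : σ → ℂ), u i = ω ^ k * s * u j → eval u p = 0)
    (hMu : ∀ k : ℕ, ∃ u : σ → ℂ, u i = ω ^ k * s ∧ u j = 1 ∧ eval u M ≠ 0) :
    (X i ^ 3 - C (s ^ 3) * X j ^ 3) * M ∣ p := by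
  have e : (X i ^ 3 - C (s ^ 3) * X j ^ 3) * M = (X i - C (ω ^ 0 * s) * X j) *
      ((X i - C (ω ^ 1 * s) * X j) * ((X i - C (ω ^ 2 * s) * X j) * M)) := by
    have hC : (C ω : MvPolynomial σ ℂ) ^ 2 + C ω + 1 = 0 := by
      rw [← C_pow, ← C_add, ← C_1, ← C_add, h, C_0]
    simp only [map_mul, map_pow, pow_zero, one_mul, pow_one]
    grind
  obtain ⟨u0, hi0, hj0, hu0⟩ := hMu 0
  obtain ⟨u1, hi1, hj1, hu1⟩ := hMu 1
  obtain ⟨u2, hi2, hj2, hu2⟩ := hMu 2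
  have hw1 : ω ≠ 1 := by rintro rfl; norm_num at h
  have hw0 : ω ≠ 0 := by rintro rfl; norm_num at h
  have hw2 : ω ^ 2 ≠ 1 := by grind
  rw [e]
  refine linear_mul_dvd hij _ (linear_mul_dvd hij _ (linear_mul_dvd hij _ hM (hp 2) (u := u2) ?_ hu2)
    (hp 1) (u := u1) ?_ ?_) (hp 0) (u := u0) ?_ ?_
  · rw [hi2, hj2, mul_one]
  · rw [hi1, hj1, mul_one]
  · simp [hi1, hj1, hu1]
    grind
  · rw [hi0, hj0, mul_one]
  · simp [hi0, hj0, hu0]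
    grind

theorem eval_quotient_eq {L : σ → MvPolynomial σ ℂ} {f H : MvPolynomial σ ℂ} (hf : f ≠ 0) {ψ χ : ℂ}
    (h1 : ∀ u, eval (fun s => eval u (L s)) f = ψ * eval u f)
    (h2 : ∀ u, eval (fun s => eval u (L s)) (f * H) = χ * eval u (f * H)) (u : σ → ℂ) :
    ψ * eval (fun s => eval u (L s)) H = χ * eval u H := by
  have e1 : f * (C ψ * aeval L H - C χ * H) = 0 := by
    refine MvPolynomial.funext fun u => ?_
    have := h2 u
    rw [map_mul, h1] at this
    simp only [map_mul, map_sub, eval_C, eval_aeval_apply, map_zero]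
    rw [map_mul] at this
    linear_combination this
  have e2 := congrArg (eval u) ((mul_eq_zero.mp e1).resolve_left hf)
  simp only [map_mul, map_sub, eval_C, eval_aeval_apply, map_zero] at e2
  linear_combination e2

theorem isHomogeneous_quotient {d e : ℕ} {f H : MvPolynomial σ ℂ} (hf : f ≠ 0)
    (hfe : f.IsHomogeneous e) (h : (f * H).IsHomogeneous d) (hH : H ≠ 0) :
    e ≤ d ∧ H.IsHomogeneous (d - e) := by
  have key (n : ℕ) (hn : homogeneousComponent n H ≠ 0) : e + n = d := by
    by_contra hne
    have e1 : homogeneousComponent (e + n) (f * H) = f * homogeneousComponent n H := by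
      conv_lhs => rw [← sum_homogeneousComponent H, Finset.mul_sum, map_sum]
      rw [Finset.sum_eq_single n]
      · rw [homogeneousComponent_of_mem (hfe.mul (homogeneousComponent_isHomogeneous n H)), if_pos rfl]
      · intro m _ hm
        rw [homogeneousComponent_of_mem (hfe.mul (homogeneousComponent_isHomogeneous m H)),
          if_neg (by omega)]
      · intro hr
        exact absurd (homogeneousComponent_eq_zero n H (by simpa using hr)) hn
    rw [homogeneousComponent_of_mem h, if_neg hne] at e1
    exact mul_ne_zero hf hn e1.symm
  obtain ⟨n, hn⟩ : ∃ n, homogeneousComponent n H ≠ 0 := by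
    by_contra! hc
    exact hH (by rw [← sum_homogeneousComponent H]; exact Finset.sum_eq_zero fun n _ => hc n)
  have hd := key n hn
  refine ⟨by omega, ?_⟩
  rw [← sum_homogeneousComponent H]
  refine IsHomogeneous.sum _ _ _ fun m _ => ?_
  by_cases hm : homogeneousComponent m H = 0
  · rw [hm]
    exact isHomogeneous_zero _ _ _
  · rw [show d - e = m by have := key m hm; omega]
    exact homogeneousComponent_isHomogeneous _ _

theorem eq_C_of_isHomogeneous_zero {p : MvPolynomial σ ℂ} (h : p.IsHomogeneous 0) :
    ∃ c, p = C c := by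
  exact ⟨_, totalDegree_eq_zero_iff_eq_C.mp (Nat.le_zero.mp h.totalDegree_le)⟩

end LinearForms

section Binary

/-- Binary forms of degree `d` on which the diagonal reflection acts through the scalar `χ` and that
are invariant under the restriction of the Fourier matrix. -/
def binInv (ω χ : ℂ) (d : ℕ) : Submodule ℂ (MvPolynomial (Fin 2) ℂ) where
  carrier := {E | E.IsHomogeneous d ∧ (∀ a b, eval ![ω * a, b] E = χ * eval ![a, b] E) ∧
    ∀ a b, eval ![(1 + 2 * ω) / 3 * (a + 2 * b), (1 + 2 * ω) / 3 * (a - b)] E = eval ![a, b] E}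
  add_mem' := by
    rintro F G ⟨h1, h2, h3⟩ ⟨k1, k2, k3⟩
    exact ⟨h1.add k1, fun a b => by rw [map_add, map_add, h2, k2, mul_add],
      fun a b => by rw [map_add, map_add, h3, k3]⟩
  zero_mem' := ⟨isHomogeneous_zero _ _ _, fun _ _ => by rw [map_zero, map_zero, mul_zero],
    fun _ _ => by rw [map_zero, map_zero]⟩
  smul_mem' := by
    rintro t F ⟨h1, h2, h3⟩
    exact ⟨(homogeneousSubmodule _ ℂ d).smul_mem t h1,
      fun a b => by rw [smul_eval, smul_eval, h2, mul_left_comm],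
      fun a b => by rw [smul_eval, smul_eval, h3]⟩

theorem pow_mem_binInv {ω : ℂ} {d : ℕ} {E : MvPolynomial (Fin 2) ℂ} (h : E ∈ binInv ω 1 d) (n : ℕ) :
    E ^ n ∈ binInv ω 1 (d * n) :=
  ⟨h.1.pow n, fun a b => by rw [map_pow, map_pow, h.2.1, one_mul, one_mul],
    fun a b => by rw [map_pow, map_pow, h.2.2]⟩

/-- The product of the four linear forms in the orbit of `a`. -/
def quartic : MvPolynomial (Fin 2) ℂ := (X 0 ^ 3 - C ((-2) ^ 3) * X 1 ^ 3) * X 0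

theorem eval_quartic (u : Fin 2 → ℂ) : eval u quartic = (u 0 ^ 3 + 8 * u 1 ^ 3) * u 0 := by
  simp only [quartic, map_mul, map_sub, map_pow, eval_X, eval_C]
  ring

theorem quartic_ne_zero : quartic ≠ 0 := by
  intro h
  have := congrArg (eval ![1, 0]) h
  rw [eval_quartic] at this
  simp at this

theorem isHomogeneous_quartic : quartic.IsHomogeneous 4 := by
  have h := (((isHomogeneous_X_pow (0 : Fin 2) 3).sub
    ((isHomogeneous_C (Fin 2) ((-2 : ℂ) ^ 3)).mul (isHomogeneous_X_pow (1 : Fin 2) 3))).mul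
      (isHomogeneous_X ℂ (0 : Fin 2)))
  exact h

variable {ω : ℂ}

theorem exists_quartic_mul (h : ω ^ 2 + ω + 1 = 0) {χ : ℂ} {d : ℕ} {E : MvPolynomial (Fin 2) ℂ}
    (hE : E ∈ binInv ω χ d) (h0 : ∀ b, eval ![0, b] E = 0) (hne : E ≠ 0) :
    4 ≤ d ∧ ∃ E' ∈ binInv ω (ω ^ 2 * χ) (d - 4), E = quartic * E' := by
  have h3 : ω ^ 3 = 1 := by linear_combination (ω - 1) * h
  obtain ⟨hd, hω, hD⟩ := hE
  have hu (u : Fin 2 → ℂ) : u = ![u 0, u 1] := by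
    funext i
    fin_cases i <;> rfl
  have hX : X 0 ∣ E := by
    have := linear_dvd_of_eval_eq_zero (i := (0 : Fin 2)) (j := 1) (by decide) 0 (p := E)
      fun u hu0 => by
        rw [hu u, hu0, zero_mul]
        exact h0 _
    simpa using this
  have hdvd : quartic ∣ E := by
    refine cubic_mul_dvd h (by decide) (by norm_num) hX (fun k u huk => ?_) fun k =>
      ⟨![ω ^ k * -2, 1], by simp, by simp, by simp [show ω ≠ 0 by rintro rfl; norm_num at h]⟩
    have base (b : ℂ) : eval ![-2 * b, b] E = 0 := by
      rw [← hD, show -2 * b + 2 * b = 0 by ring, mul_zero]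
      exact h0 _
    have step (k : ℕ) (b : ℂ) : eval ![ω ^ k * (-2 * b), b] E = 0 := by
      induction k with
      | zero => rw [pow_zero, one_mul, base]
      | succ k ih => rw [pow_succ', mul_assoc, hω, ih, mul_zero]
    rw [hu u, huk, mul_assoc]
    exact step _ _
  obtain ⟨E', rfl⟩ := hdvd
  have hE' : E' ≠ 0 := right_ne_zero_of_mul hne
  obtain ⟨hle, hhom⟩ := isHomogeneous_quotient quartic_ne_zero isHomogeneous_quartic hd hE'
  refine ⟨hle, E', ⟨hhom, fun a b => ?_, fun a b => ?_⟩, rfl⟩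
  · have := eval_quotient_eq (L := ![C ω * X 0, X 1]) (f := quartic) (H := E') quartic_ne_zero
      (ψ := ω) (χ := χ) ?_ ?_ ![a, b]
    · have e : (fun s => eval ![a, b] ((![C ω * X 0, X 1] : Fin 2 → MvPolynomial (Fin 2) ℂ) s)) =
          ![ω * a, b] := by
        funext i
        fin_cases i <;> simp
      rw [e] at this
      linear_combination ω ^ 2 * this - eval ![ω * a, b] E' * h3
    · intro u
      simp only [eval_quartic]
      simp
      linear_combination ω * u 0 ^ 4 * h3
    · intro u
      have e : (fun s => eval u ((![C ω * X 0, X 1] : Fin 2 → MvPolynomial (Fin 2) ℂ) s)) =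
          ![ω * u 0, u 1] := by
        funext i
        fin_cases i <;> simp
      rw [e, hω, ← hu u]
  · have e (u : Fin 2 → ℂ) : (fun s => eval u ((![C ((1 + 2 * ω) / 3) * (X 0 + C 2 * X 1),
          C ((1 + 2 * ω) / 3) * (X 0 - X 1)] : Fin 2 → MvPolynomial (Fin 2) ℂ) s)) =
          ![(1 + 2 * ω) / 3 * (u 0 + 2 * u 1), (1 + 2 * ω) / 3 * (u 0 - u 1)] := by
      funext i
      fin_cases i <;> simp
    have := eval_quotient_eq (L := ![C ((1 + 2 * ω) / 3) * (X 0 + C 2 * X 1),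
      C ((1 + 2 * ω) / 3) * (X 0 - X 1)]) (f := quartic) (H := E') quartic_ne_zero
      (ψ := 1) (χ := 1) ?_ ?_ ![a, b]
    · rw [e] at this
      simpa using this
    · intro u
      rw [e]
      simp only [eval_quartic]
      simp
      grind
    · intro u
      rw [e, hD, ← hu u, one_mul]

theorem eval_zero_eq_zero {χ : ℂ} (hχ : χ ≠ 1) {d : ℕ} {E : MvPolynomial (Fin 2) ℂ}
    (hE : E ∈ binInv ω χ d) (b : ℂ) : eval ![0, b] E = 0 := by
  have := hE.2.1 0 b
  rw [mul_zero] at this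
  by_contra hne
  exact hχ (mul_right_cancel₀ hne (by rw [one_mul, ← this]))

theorem exists_quartic_pow_mul (h : ω ^ 2 + ω + 1 = 0) {d : ℕ} {E : MvPolynomial (Fin 2) ℂ}
    (hE : E ∈ binInv ω 1 d) (h0 : eval ![0, 1] E = 0) (hne : E ≠ 0) :
    12 ≤ d ∧ ∃ E' ∈ binInv ω 1 (d - 12), E = quartic ^ 3 * E' := by
  have h3 : ω ^ 3 = 1 := by linear_combination (ω - 1) * h
  have hw1 : ω ≠ 1 := by rintro rfl; norm_num at h
  have h0' (b : ℂ) : eval ![0, b] E = 0 := by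
    have e : ![0, b] = b • ![0, (1 : ℂ)] := by
      funext i
      fin_cases i <;> simp
    rw [e, eval_smul_of_isHomogeneous hE.1, h0, mul_zero]
  obtain ⟨hd1, E1, hE1, rfl⟩ := exists_quartic_mul h hE h0' hne
  have hne1 := right_ne_zero_of_mul hne
  obtain ⟨hd2, E2, hE2, rfl⟩ := exists_quartic_mul h hE1
    (eval_zero_eq_zero (by grind) hE1) hne1
  have hne2 := right_ne_zero_of_mul hne1
  obtain ⟨hd3, E3, hE3, rfl⟩ := exists_quartic_mul h hE2
    (eval_zero_eq_zero (by grind) hE2) hne2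
  refine ⟨by omega, E3, ?_, by ring⟩
  rw [show ω ^ 2 * (ω ^ 2 * (ω ^ 2 * 1)) = 1 by grind, Nat.sub_sub, Nat.sub_sub] at hE3
  exact hE3

theorem even_of_eval_ne_zero (h : ω ^ 2 + ω + 1 = 0) {χ : ℂ} {d : ℕ} {E : MvPolynomial (Fin 2) ℂ}
    (hE : E ∈ binInv ω χ d) (hne : E ≠ 0) : Even d := by
  obtain ⟨u, hu⟩ : ∃ u, eval u E ≠ 0 := by
    by_contra! hc
    exact hne (MvPolynomial.funext fun u => by rw [hc, map_zero])
  have e : ![(1 + 2 * ω) / 3 * ((1 + 2 * ω) / 3 * (u 0 + 2 * u 1) + 2 * ((1 + 2 * ω) / 3 * (u 0 - u 1))),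
      (1 + 2 * ω) / 3 * ((1 + 2 * ω) / 3 * (u 0 + 2 * u 1) - (1 + 2 * ω) / 3 * (u 0 - u 1))] =
      (-1 : ℂ) • u := by
    funext i
    fin_cases i <;> simp <;> grind
  have e1 : ![u 0, u 1] = u := by
    funext i
    fin_cases i <;> rfl
  have := hE.2.2 ((1 + 2 * ω) / 3 * (u 0 + 2 * u 1)) ((1 + 2 * ω) / 3 * (u 0 - u 1))
  rw [e, hE.2.2 (u 0) (u 1), e1, eval_smul_of_isHomogeneous hE.1] at this
  by_contra hodd
  rw [(Nat.not_even_iff_odd.mp hodd).neg_one_pow] at this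
  exact hu (by linear_combination -this / 2)

theorem binInv_le_span (h : ω ^ 2 + ω + 1 = 0) {p q : MvPolynomial (Fin 2) ℂ}
    (hp : p ∈ binInv ω 1 6) (hq : q ∈ binInv ω 1 12) (hp0 : eval ![0, 1] p ≠ 0)
    (hq0 : eval ![0, 1] q = 0) (hqne : q ≠ 0) {d : ℕ} (hd : 3 ∣ d) {E : MvPolynomial (Fin 2) ℂ}
    (hE : E ∈ binInv ω 1 d) :
    E ∈ Submodule.span ℂ {F | ∃ i j, 6 * i + 12 * j = d ∧ F = p ^ i * q ^ j} := by
  obtain ⟨-, q', hq', hqq⟩ := exists_quartic_pow_mul h hq hq0 hqne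
  obtain ⟨c, rfl⟩ := eq_C_of_isHomogeneous_zero hq'.1
  have hc : c ≠ 0 := by
    rintro rfl
    simp [hqne] at hqq
  induction d using Nat.strong_induction_on generalizing E with
  | _ d ih =>
  have vanish {E : MvPolynomial (Fin 2) ℂ} (hE : E ∈ binInv ω 1 d) (h0 : eval ![0, 1] E = 0) :
      E ∈ Submodule.span ℂ {F | ∃ i j, 6 * i + 12 * j = d ∧ F = p ^ i * q ^ j} := by
    by_cases hne : E = 0
    · rw [hne]
      exact zero_mem _
    obtain ⟨hle, E', hE', rfl⟩ := exists_quartic_pow_mul h hE h0 hne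
    have hmem := ih (d - 12) (by omega) (by omega) hE'
    have e : quartic ^ 3 * E' = LinearMap.mulLeft ℂ (c⁻¹ • q) E' := by
      have hcc : (C c⁻¹ : MvPolynomial (Fin 2) ℂ) * C c = 1 := by
        rw [← C_mul, inv_mul_cancel₀ hc, C_1]
      rw [LinearMap.mulLeft_apply, hqq, smul_eq_C_mul]
      linear_combination - quartic ^ 3 * E' * hcc
    rw [e]
    refine Submodule.span_induction (p := fun x _ => LinearMap.mulLeft ℂ (c⁻¹ • q) x ∈ _)
      ?_ (by rw [map_zero]; exact zero_mem _)
      (fun x y _ _ hx hy => by rw [map_add]; exact add_mem hx hy)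
      (fun t x _ hx => by rw [map_smul]; exact Submodule.smul_mem _ _ hx) hmem
    rintro _ ⟨i, j, hij, rfl⟩
    rw [LinearMap.mulLeft_apply, smul_mul_assoc]
    refine Submodule.smul_mem _ _ (Submodule.subset_span ⟨i, j + 1, by omega, by ring⟩)
  by_cases h0 : eval ![0, 1] E = 0
  · exact vanish hE h0
  have hev : Even d := even_of_eval_ne_zero h hE (by rintro rfl; simp at h0)
  obtain ⟨m, rfl⟩ : ∃ m, d = 6 * m := ⟨d / 6, by have := hev.two_dvd; omega⟩
  set s : ℂ := eval ![0, 1] E / eval ![0, 1] p ^ m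
  have hpm := pow_mem_binInv hp m
  rw [← sub_add_cancel E (s • p ^ m)]
  refine add_mem (vanish (sub_mem hE (Submodule.smul_mem _ s hpm)) ?_)
    (Submodule.smul_mem _ _ (Submodule.subset_span ⟨m, 0, by omega, by ring⟩))
  rw [map_sub, smul_eval, map_pow, div_mul_cancel₀ _ (pow_ne_zero m hp0), sub_self]

end Binary

section Ternary

variable {ω : ℂ} {d e : ℕ} {F G : MvPolynomial (Fin 3) ℂ}

theorem mul_mem_weylInv (hF : F ∈ weylInv ω d) (hG : G ∈ weylInv ω e) :
    F * G ∈ weylInv ω (d + e) :=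
  ⟨hF.1.mul hG.1, fun a b c => by rw [map_mul, map_mul, hF.2.1, hG.2.1],
    fun a b c => by rw [map_mul, map_mul, hF.2.2.1, hG.2.2.1],
    fun a b c => by rw [map_mul, map_mul, hF.2.2.2, hG.2.2.2]⟩

theorem one_mem_weylInv : (1 : MvPolynomial (Fin 3) ℂ) ∈ weylInv ω 0 :=
  ⟨isHomogeneous_one _ _, fun a b c => by rw [map_one, map_one],
    fun a b c => by rw [map_one, map_one], fun a b c => by rw [map_one, map_one]⟩

theorem pow_mem_weylInv (hF : F ∈ weylInv ω d) (n : ℕ) : F ^ n ∈ weylInv ω (d * n) := by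
  induction n with
  | zero => exact one_mem_weylInv
  | succ n ih => exact mul_mem_weylInv ih hF

theorem eval_diagonal_of_mem_weylInv (hF : F ∈ weylInv ω d) (k l m : ℕ) (a b c : ℂ) :
    eval ![ω ^ k * a, ω ^ l * b, ω ^ m * c] F = eval ![a, b, c] F := by
  have key (k : ℕ) (a b c : ℂ) : eval ![ω ^ k * a, b, c] F = eval ![a, b, c] F := by
    induction k with
    | zero => rw [pow_zero, one_mul]
    | succ k ih => rw [pow_succ', mul_assoc, hF.2.1, ih]
  rw [key, ← hF.2.2.1, key, hF.2.2.1, ← hF.2.2.1, ← hF.2.2.1, key, hF.2.2.1, hF.2.2.1]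

theorem vec_three_eta (u : Fin 3 → ℂ) : u = ![u 0, u 1, u 2] := by
  funext i
  fin_cases i <;> rfl

theorem three_dvd_of_mem_weylInv (h : ω ^ 2 + ω + 1 = 0) (hF : F ∈ weylInv ω d) (hne : F ≠ 0) :
    3 ∣ d := by
  obtain ⟨u, hu⟩ : ∃ u, eval u F ≠ 0 := by
    by_contra! hc
    exact hne (MvPolynomial.funext fun u => by rw [hc, map_zero])
  have h3 : ω ^ 3 = 1 := by linear_combination (ω - 1) * h
  have hw1 : ω ≠ 1 := by rintro rfl; norm_num at h
  have e : ![ω ^ 1 * u 0, ω ^ 1 * u 1, ω ^ 1 * u 2] = ω • u := by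
    funext i
    fin_cases i <;> simp
  have := eval_diagonal_of_mem_weylInv hF 1 1 1 (u 0) (u 1) (u 2)
  rw [e, ← vec_three_eta, eval_smul_of_isHomogeneous hF.1] at this
  have hd : ω ^ d = 1 := mul_right_cancel₀ hu (by rw [this, one_mul])
  rw [← orderOf_eq_prime h3 hw1]
  exact orderOf_dvd_of_pow_eq_one hd

/-- Restriction to the plane where the last two coordinates agree. -/
def planeRes : MvPolynomial (Fin 3) ℂ →ₐ[ℂ] MvPolynomial (Fin 2) ℂ := aeval ![X 0, X 1, X 1]

theorem eval_planeRes (F : MvPolynomial (Fin 3) ℂ) (a b : ℂ) :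
    eval ![a, b] (planeRes F) = eval ![a, b, b] F := by
  rw [planeRes, eval_aeval_apply]
  congr 2
  funext i
  fin_cases i <;> simp

theorem planeRes_mem_binInv (h : ω ^ 2 + ω + 1 = 0) (hF : F ∈ weylInv ω d) :
    planeRes F ∈ binInv ω 1 d := by
  refine ⟨?_, fun a b => ?_, fun a b => ?_⟩
  · have := hF.1.aeval (![X 0, X 1, X 1] : Fin 3 → MvPolynomial (Fin 2) ℂ) (n := 1) fun v => by
      fin_cases v <;> exact isHomogeneous_X _ _
    rwa [one_mul] at this
  · rw [eval_planeRes, eval_planeRes, hF.2.1, one_mul]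
  · rw [eval_planeRes, eval_planeRes, ← hF.2.2.2 a b b]
    congr 2
    funext i
    fin_cases i <;> simp <;> grind

/-- The product of the linear forms defining the reflecting hyperplanes in the orbit of `b = c`. -/
def mirrorForm : MvPolynomial (Fin 3) ℂ :=
  (X 1 ^ 3 - C (1 ^ 3) * X 2 ^ 3) * ((X 2 ^ 3 - C (1 ^ 3) * X 0 ^ 3) *
    ((X 0 ^ 3 - C (1 ^ 3) * X 1 ^ 3) * 1))

theorem mirrorForm_dvd (h : ω ^ 2 + ω + 1 = 0) (hF : F ∈ weylInv ω d) (h0 : planeRes F = 0) :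
    mirrorForm ∣ F := by
  have h3 : ω ^ 3 = 1 := by linear_combination (ω - 1) * h
  have hw (k : ℕ) : (ω ^ k) ^ 3 = 1 := by rw [← pow_mul, mul_comm, pow_mul, h3, one_pow]
  have van (a b : ℂ) (k : ℕ) : eval ![a, ω ^ k * 1 * b, b] F = 0 := by
    have := eval_diagonal_of_mem_weylInv hF 0 k 0 a b b
    rw [pow_zero, one_mul, one_mul] at this
    rw [mul_one, this, ← eval_planeRes, h0, map_zero]
  refine cubic_mul_dvd h (by decide) one_ne_zero (cubic_mul_dvd h (by decide) one_ne_zero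
    (cubic_mul_dvd h (by decide) one_ne_zero (one_dvd F) (fun k u hu => ?_)
    fun k => ⟨![ω ^ k, 1, 0], by simp, by simp, by simp⟩) (fun k u hu => ?_)
    fun k => ⟨![1, 0, ω ^ k], by simp, by simp, by simp⟩) (fun k u hu => ?_)
    fun k => ⟨![0, ω ^ k, 1], by simp, by simp, by simp [hw k]⟩
  · rw [vec_three_eta u, hu, ← hF.2.2.1, ← hF.2.2.1]
    exact van _ _ _
  · rw [vec_three_eta u, hu, ← hF.2.2.1]
    exact van _ _ _
  · rw [vec_three_eta u, hu]
    exact van _ _ _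

theorem isHomogeneous_mirrorForm : mirrorForm.IsHomogeneous 9 := by
  have key (i j : Fin 3) : (X i ^ 3 - C ((1 : ℂ) ^ 3) * X j ^ 3).IsHomogeneous 3 :=
    (isHomogeneous_X_pow i 3).sub ((isHomogeneous_C _ _).mul (isHomogeneous_X_pow j 3))
  exact (key 1 2).mul ((key 2 0).mul ((key 0 1).mul (isHomogeneous_one _ _)))

theorem quotient_mem_weylInv {H : MvPolynomial (Fin 3) ℂ} (hF : F ∈ weylInv ω d) (hF0 : F ≠ 0)
    (hH0 : H ≠ 0) (hFH : F * H ∈ weylInv ω e) : d ≤ e ∧ H ∈ weylInv ω (e - d) := by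
  obtain ⟨hle, hhom⟩ := isHomogeneous_quotient hF0 hF.1 hFH.1 hH0
  refine ⟨hle, hhom, fun a b c => ?_, fun a b c => ?_, fun a b c => ?_⟩
  · have e (u : Fin 3 → ℂ) : (fun s => eval u ((![C ω * X 0, X 1, X 2] :
        Fin 3 → MvPolynomial (Fin 3) ℂ) s)) = ![ω * u 0, u 1, u 2] := by
      funext i
      fin_cases i <;> simp
    have := eval_quotient_eq (L := ![C ω * X 0, X 1, X 2]) (f := F) (H := H) hF0 (ψ := 1) (χ := 1)
      (fun u => by rw [e, hF.2.1, ← vec_three_eta, one_mul])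
      (fun u => by rw [e, hFH.2.1, ← vec_three_eta, one_mul]) ![a, b, c]
    rw [e, one_mul, one_mul] at this
    exact this
  · have e (u : Fin 3 → ℂ) : (fun s => eval u ((![X 1, X 2, X 0] :
        Fin 3 → MvPolynomial (Fin 3) ℂ) s)) = ![u 1, u 2, u 0] := by
      funext i
      fin_cases i <;> simp
    have := eval_quotient_eq (L := ![X 1, X 2, X 0]) (f := F) (H := H) hF0 (ψ := 1) (χ := 1)
      (fun u => by rw [e, hF.2.2.1, ← vec_three_eta, one_mul])
      (fun u => by rw [e, hFH.2.2.1, ← vec_three_eta, one_mul]) ![a, b, c]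
    rw [e, one_mul, one_mul] at this
    exact this
  · set L : Fin 3 → MvPolynomial (Fin 3) ℂ := ((1 + 2 * ω) / 3) • ![X 0 + X 1 + X 2,
      X 0 + C (ω ^ 2) * X 1 + C ω * X 2, X 0 + C ω * X 1 + C (ω ^ 2) * X 2] with hL
    have e (u : Fin 3 → ℂ) : (fun s => eval u (L s)) = ((1 + 2 * ω) / 3) • ![u 0 + u 1 + u 2,
        u 0 + ω ^ 2 * u 1 + ω * u 2, u 0 + ω * u 1 + ω ^ 2 * u 2] := by
      funext i
      fin_cases i <;> simp [hL, smul_eval] <;> ring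
    have := eval_quotient_eq (L := L) (f := F) (H := H) hF0 (ψ := 1) (χ := 1)
      (fun u => by rw [e, hF.2.2.2, ← vec_three_eta, one_mul])
      (fun u => by rw [e, hFH.2.2.2, ← vec_three_eta, one_mul]) ![a, b, c]
    rw [e, one_mul, one_mul] at this
    exact this

theorem planeRes_eq_zero_of_odd (h : ω ^ 2 + ω + 1 = 0) (hF : F ∈ weylInv ω d) (hd : Odd d) :
    planeRes F = 0 := by
  by_contra hne
  exact Nat.not_even_iff_odd.mpr hd (even_of_eval_ne_zero h (planeRes_mem_binInv h hF) hne)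

theorem weylInv_le_span (h : ω ^ 2 + ω + 1 = 0) {f₆ f₉ f₁₂ : MvPolynomial (Fin 3) ℂ}
    (h6 : f₆ ∈ weylInv ω 6) (h9 : f₉ ∈ weylInv ω 9) (h12 : f₁₂ ∈ weylInv ω 12)
    (h60 : eval ![0, 1, 1] f₆ ≠ 0) (h90 : f₉ ≠ 0) (h120 : eval ![0, 1, 1] f₁₂ = 0)
    (h12ne : planeRes f₁₂ ≠ 0) (hF : F ∈ weylInv ω d) :
    F ∈ Submodule.span ℂ
      {G | ∃ i j k, 6 * i + 9 * j + 12 * k = d ∧ G = f₆ ^ i * f₉ ^ j * f₁₂ ^ k} := by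
  obtain ⟨m, hm⟩ := mirrorForm_dvd h h9 (planeRes_eq_zero_of_odd h h9 (by decide))
  have hm0 : m ≠ 0 := by
    rintro rfl
    exact h90 (by rw [hm, mul_zero])
  have hmir0 : mirrorForm ≠ 0 := by
    intro h0
    exact h90 (by rw [hm, h0, zero_mul])
  obtain ⟨-, hhom⟩ := isHomogeneous_quotient hmir0 isHomogeneous_mirrorForm (hm ▸ h9.1) hm0
  obtain ⟨c, rfl⟩ := eq_C_of_isHomogeneous_zero hhom
  have hc : c ≠ 0 := by
    rintro rfl
    exact hm0 C_0
  induction d using Nat.strong_induction_on generalizing F with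
  | _ d ih =>
  have vanish {F : MvPolynomial (Fin 3) ℂ} (hF : F ∈ weylInv ω d) (h0 : planeRes F = 0) :
      F ∈ Submodule.span ℂ
        {G | ∃ i j k, 6 * i + 9 * j + 12 * k = d ∧ G = f₆ ^ i * f₉ ^ j * f₁₂ ^ k} := by
    by_cases hne : F = 0
    · rw [hne]
      exact zero_mem _
    obtain ⟨H, rfl⟩ := mirrorForm_dvd h hF h0
    have hcc : (C c : MvPolynomial (Fin 3) ℂ) * C c⁻¹ = 1 := by
      rw [← C_mul, mul_inv_cancel₀ hc, C_1]
    have e : mirrorForm * H = f₉ * (C c⁻¹ * H) := by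
      rw [hm]
      linear_combination - mirrorForm * H * hcc
    rw [e] at hF hne ⊢
    obtain ⟨hle, hH⟩ := quotient_mem_weylInv h9 h90 (right_ne_zero_of_mul hne) hF
    have hmem := ih (d - 9) (by omega) hH
    rw [← LinearMap.mulLeft_apply (R := ℂ)]
    refine Submodule.span_induction (p := fun x _ => LinearMap.mulLeft ℂ f₉ x ∈ _)
      ?_ (by rw [map_zero]; exact zero_mem _)
      (fun x y _ _ hx hy => by rw [map_add]; exact add_mem hx hy)
      (fun t x _ hx => by rw [map_smul]; exact Submodule.smul_mem _ _ hx) hmem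
    rintro _ ⟨i, j, k, hij, rfl⟩
    rw [LinearMap.mulLeft_apply]
    exact Submodule.subset_span ⟨i, j + 1, k, by omega, by ring⟩
  by_cases hne : F = 0
  · rw [hne]
    exact zero_mem _
  have hspan := binInv_le_span h (planeRes_mem_binInv h h6) (planeRes_mem_binInv h h12)
    (by rwa [eval_planeRes]) (by rwa [eval_planeRes]) h12ne (three_dvd_of_mem_weylInv h hF hne)
    (planeRes_mem_binInv h hF)
  have hlift : ∃ F₀ ∈ weylInv ω d ⊓ Submodule.span ℂ
      {G | ∃ i j k, 6 * i + 9 * j + 12 * k = d ∧ G = f₆ ^ i * f₉ ^ j * f₁₂ ^ k},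
      planeRes F₀ = planeRes F := by
    refine Submodule.span_induction (p := fun x _ => ∃ F₀ ∈ weylInv ω d ⊓ Submodule.span ℂ
      {G | ∃ i j k, 6 * i + 9 * j + 12 * k = d ∧ G = f₆ ^ i * f₉ ^ j * f₁₂ ^ k},
      planeRes F₀ = x) ?_ ⟨0, zero_mem _, map_zero _⟩ ?_ ?_ hspan
    · rintro _ ⟨i, j, rfl, rfl⟩
      refine ⟨f₆ ^ i * f₁₂ ^ j, ⟨mul_mem_weylInv (pow_mem_weylInv h6 i) (pow_mem_weylInv h12 j),
        Submodule.subset_span ⟨i, 0, j, by omega, by ring⟩⟩, by simp only [map_mul, map_pow]⟩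
    · rintro _ _ - - ⟨x, hx, rfl⟩ ⟨y, hy, rfl⟩
      exact ⟨x + y, add_mem hx hy, map_add _ _ _⟩
    · rintro t _ - ⟨x, hx, rfl⟩
      exact ⟨t • x, Submodule.smul_mem _ t hx, map_smul _ _ _⟩
  obtain ⟨F₀, ⟨hW, hS⟩, he⟩ := hlift
  rw [← sub_add_cancel F F₀]
  exact add_mem (vanish (sub_mem hF hW) (by rw [map_sub, he, sub_self])) hS

end Ternary

section Independence

theorem eval₂RingHom_injective {S A B : Type*} [CommRing S] [CommRing A] [IsDomain A] [CommRing B]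
    {ι : S →+* A} (r : A →+* B) {y : A} (hι : Function.Injective (r.comp ι)) (hy : y ≠ 0)
    (hr : r y = 0) : Function.Injective (Polynomial.eval₂RingHom ι y) := by
  refine (injective_iff_map_eq_zero _).mpr fun P => ?_
  induction hn : P.natDegree using Nat.strong_induction_on generalizing P with
  | _ n ih =>
  intro hP
  have hP0 : P.coeff 0 = 0 := by
    refine (injective_iff_map_eq_zero _).mp hι _ ?_
    have := congrArg r hP
    rw [← P.divX_mul_X_add] at this
    simpa [hr] using this
  have hX := P.divX_mul_X_add
  rw [hP0, Polynomial.C_0, add_zero] at hX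
  by_cases h0 : P.natDegree = 0
  · rw [Polynomial.eq_C_of_natDegree_eq_zero h0, hP0, Polynomial.C_0]
  · rw [← hX, map_mul, mul_eq_zero] at hP
    have hdiv := ih _ (by rw [← hn, Polynomial.natDegree_divX_eq_natDegree_tsub_one]; omega)
      P.divX rfl (hP.resolve_right (by simpa using hy))
    rw [← hX, hdiv, zero_mul]

theorem linearIndependent_monomials {d e : ℕ} (hd : d ≠ 0) {f₆ f₉ f₁₂ : MvPolynomial (Fin 3) ℂ}
    (h6 : f₆.IsHomogeneous d) (h12 : f₁₂.IsHomogeneous e)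
    (h60 : eval ![0, 1, 1] f₆ ≠ 0) (h9ne : f₉ ≠ 0) (h90 : planeRes f₉ = 0)
    (h120 : eval ![0, 1, 1] f₁₂ = 0) (h12ne : planeRes f₁₂ ≠ 0) :
    LinearIndependent ℂ fun t : ℕ × ℕ × ℕ => f₆ ^ t.1 * f₉ ^ t.2.1 * f₁₂ ^ t.2.2 := by
  set r : MvPolynomial (Fin 2) ℂ →ₐ[ℂ] Polynomial ℂ := aeval ![0, Polynomial.X] with hr
  have hrev (p : MvPolynomial (Fin 2) ℂ) (t : ℂ) : (r p).eval t = eval ![0, t] p := by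
    have : (Polynomial.aeval t).comp r = aeval ![0, t] := by
      ext i
      fin_cases i <;> simp [hr]
    exact DFunLike.congr_fun this p
  have hscale {n : ℕ} {f : MvPolynomial (Fin 3) ℂ} (hf : f.IsHomogeneous n) (t : ℂ) :
      (r (planeRes f)).eval t = t ^ n * eval ![0, 1, 1] f := by
    rw [hrev, eval_planeRes, ← eval_smul_of_isHomogeneous hf]
    congr 2
    funext i
    fin_cases i <;> simp
  set ι : Polynomial ℂ →+* MvPolynomial (Fin 2) ℂ :=
    Polynomial.eval₂RingHom C (planeRes f₆) with hι
  have inj1 : Function.Injective ((r : MvPolynomial (Fin 2) ℂ →+* Polynomial ℂ).comp ι) := by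
    have e : (r : MvPolynomial (Fin 2) ℂ →+* Polynomial ℂ).comp ι =
        Polynomial.eval₂RingHom Polynomial.C (r (planeRes f₆)) := by
      refine Polynomial.ringHom_ext (fun a => ?_) ?_ <;> simp [hι, hr]
    rw [e]
    refine eval₂RingHom_injective (Polynomial.evalRingHom 0) (fun a b hab => by simpa using hab) ?_ ?_
    · intro h0
      have := hscale h6 1
      rw [h0, Polynomial.eval_zero, one_pow, one_mul] at this
      exact h60 this.symm
    · rw [Polynomial.coe_evalRingHom, hscale h6, zero_pow hd, zero_mul]
  have inj2 : Function.Injective (Polynomial.eval₂RingHom ι (planeRes f₁₂)) := by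
    refine eval₂RingHom_injective (r : MvPolynomial (Fin 2) ℂ →+* Polynomial ℂ) inj1 h12ne ?_
    refine Polynomial.funext fun t => ?_
    rw [RingHom.coe_coe, hscale h12, h120, mul_zero, Polynomial.eval_zero]
  set κ : Polynomial (Polynomial ℂ) →+* MvPolynomial (Fin 3) ℂ :=
    Polynomial.eval₂RingHom (Polynomial.eval₂RingHom C f₆) f₁₂ with hκ
  have inj3 : Function.Injective (Polynomial.eval₂RingHom κ f₉) := by
    refine eval₂RingHom_injective (planeRes : MvPolynomial (Fin 3) ℂ →+* MvPolynomial (Fin 2) ℂ)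
      ?_ h9ne h90
    have e : (planeRes : MvPolynomial (Fin 3) ℂ →+* MvPolynomial (Fin 2) ℂ).comp κ =
        Polynomial.eval₂RingHom ι (planeRes f₁₂) := by
      refine Polynomial.ringHom_ext (fun a => ?_) (by simp [hκ])
      induction a using Polynomial.induction_on' with
      | add p q hp hq => rw [map_add, map_add, map_add, hp, hq]
      | monomial n a =>
        simp [hκ, hι, Polynomial.eval₂_monomial, ← algebraMap_eq]
    rw [e]
    exact inj2
  rw [linearIndependent_iff']
  intro s g hg t ht
  have hP : ∑ t ∈ s, Polynomial.monomial t.2.1 (Polynomial.monomial t.2.2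
      (Polynomial.monomial t.1 (g t))) = 0 := by
    refine (injective_iff_map_eq_zero _).mp inj3 _ ?_
    rw [map_sum, ← hg]
    refine Finset.sum_congr rfl fun t _ => ?_
    simp only [Polynomial.coe_eval₂RingHom, Polynomial.eval₂_monomial, hκ, smul_eq_C_mul]
    ring
  have := congrArg (fun P => ((P.coeff t.2.1).coeff t.2.2).coeff t.1) hP
  simp only [Polynomial.finsetSum_coeff, Polynomial.coeff_monomial, Polynomial.coeff_zero] at this
  rw [Finset.sum_eq_single t] at this
  · simpa using this
  · intro u _ hu
    by_cases h1 : u.2.1 = t.2.1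
    · rw [if_pos h1, Polynomial.coeff_monomial]
      by_cases h2 : u.2.2 = t.2.2
      · rw [if_pos h2, Polynomial.coeff_monomial, if_neg]
        exact fun h3 => hu (Prod.ext h3 (Prod.ext h1 h2))
      · rw [if_neg h2, Polynomial.coeff_zero]
    · rw [if_neg h1, Polynomial.coeff_zero, Polynomial.coeff_zero]
  · exact fun h => absurd ht h

end Independence

section Invariants

theorem mul_mem_invSpace {d e : ℕ} {f g : MvPolynomial Idx ℂ} (hf : f ∈ invSpace 3 3 3 d)
    (hg : g ∈ invSpace 3 3 3 e) : f * g ∈ invSpace 3 3 3 (d + e) := by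
  rw [mem_invSpace_iff] at *
  exact ⟨hf.1.mul hg.1, fun A B C hA hB hC x => by
    rw [map_mul, map_mul, hf.2 A B C hA hB hC, hg.2 A B C hA hB hC]⟩

theorem pow_mem_invSpace {d : ℕ} {f : MvPolynomial Idx ℂ} (hf : f ∈ invSpace 3 3 3 d) (n : ℕ) :
    f ^ n ∈ invSpace 3 3 3 (d * n) := by
  rw [mem_invSpace_iff] at *
  exact ⟨hf.1.pow n, fun A B C hA hB hC x => by rw [map_pow, map_pow, hf.2 A B C hA hB hC]⟩

/-- The invariant of degree 12 whose restriction to the Cartan subspace vanishes at `(0, 1, 1)`. -/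
def invTwelve : MvPolynomial Idx ℂ := traceInv 4 - (1464 / 2304 : ℂ) • traceInv 2 ^ 2

theorem invTwelve_mem_invSpace : invTwelve ∈ invSpace 3 3 3 12 :=
  sub_mem (traceInv_mem_invSpace 4)
    (Submodule.smul_mem _ _ (pow_mem_invSpace (traceInv_mem_invSpace 2) 2))

theorem eval_res_traceInv_vec (n : ℕ) (a b c : ℤ) :
    eval ![(a : ℂ), b, c] (res (traceInv n)) = ((loop (intCartan ![a, b, c]) ^ n).trace : ℤ) := by
  rw [← eval_res_traceInv]
  congr 2
  funext i
  fin_cases i <;> rfl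

theorem eval_res_traceInv_two : eval ![0, 1, 1] (res (traceInv 2)) = -48 := by
  have := eval_res_traceInv_vec 2 0 1 1
  rw [trace_loop_values.2.2.1] at this
  simpa using this

theorem eval_res_invTwelve : eval ![0, 1, 1] (res invTwelve) = 0 := by
  have := eval_res_traceInv_vec 4 0 1 1
  rw [trace_loop_values.2.2.2.1] at this
  have h4 : eval ![0, 1, 1] (res (traceInv 4)) = 1464 := by simpa using this
  rw [invTwelve, map_sub, map_smul, map_sub, smul_eval, map_pow, map_pow, h4,
    eval_res_traceInv_two]
  norm_num

theorem planeRes_res_invTwelve_ne_zero : planeRes (res invTwelve) ≠ 0 := by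
  intro h0
  have h2 := eval_res_traceInv_vec 2 1 0 0
  have h4 := eval_res_traceInv_vec 4 1 0 0
  rw [trace_loop_values.1] at h2
  rw [trace_loop_values.2.1] at h4
  simp only [Int.cast_one, Int.cast_zero, Int.cast_ofNat] at h2 h4
  have := eval_planeRes (res invTwelve) 1 0
  rw [h0, map_zero, invTwelve, map_sub, map_smul, map_sub, smul_eval, map_pow, map_pow, h4, h2] at this
  norm_num at this

theorem res_traceInv_three_ne_zero : res (traceInv 3) ≠ 0 := by
  intro h0
  have := eval_res_traceInv_vec 3 0 1 (-1)
  rw [trace_loop_values.2.2.2.2, h0, map_zero] at this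
  norm_num at this

theorem exists_cube_root : ∃ ω : ℂ, ω ^ 2 + ω + 1 = 0 := by
  obtain ⟨s, hs⟩ := IsAlgClosed.exists_pow_nat_eq (-3 : ℂ) (n := 2) (by norm_num)
  exact ⟨(-1 + s) / 2, by linear_combination hs / 4⟩

/-- The monomials in the basic invariants of degrees 6, 9 and 12. -/
def invMonomial (t : ℕ × ℕ × ℕ) : MvPolynomial Idx ℂ :=
  traceInv 2 ^ t.1 * traceInv 3 ^ t.2.1 * invTwelve ^ t.2.2

theorem invMonomial_mem_invSpace (t : ℕ × ℕ × ℕ) :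
    invMonomial t ∈ invSpace 3 3 3 (6 * t.1 + 9 * t.2.1 + 12 * t.2.2) :=
  mul_mem_invSpace (mul_mem_invSpace (pow_mem_invSpace (traceInv_mem_invSpace 2) _)
    (pow_mem_invSpace (traceInv_mem_invSpace 3) _)) (pow_mem_invSpace invTwelve_mem_invSpace _)

theorem linearIndependent_invMonomial : LinearIndependent ℂ invMonomial := by
  obtain ⟨ω, h⟩ := exists_cube_root
  refine LinearIndependent.of_comp res.toLinearMap ?_
  have h9 := res_mem_weylInv h (traceInv_mem_invSpace 3)
  have key := linearIndependent_monomials (by norm_num)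
    (res_mem_weylInv h (traceInv_mem_invSpace 2)).1 (res_mem_weylInv h invTwelve_mem_invSpace).1
    (by rw [eval_res_traceInv_two]; norm_num) res_traceInv_three_ne_zero
    (planeRes_eq_zero_of_odd h h9 (by decide)) eval_res_invTwelve
    planeRes_res_invTwelve_ne_zero
  have e : res.toLinearMap ∘ invMonomial = fun t : ℕ × ℕ × ℕ =>
      res (traceInv 2) ^ t.1 * res (traceInv 3) ^ t.2.1 * res invTwelve ^ t.2.2 := by
    funext t
    simp [invMonomial]
  rw [e]
  exact key

theorem invSpace_le_span {d : ℕ} {f : MvPolynomial Idx ℂ} (hf : f ∈ invSpace 3 3 3 d) :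
    f ∈ Submodule.span ℂ
      (Set.range fun t : {p : ℕ × ℕ × ℕ // 6 * p.1 + 9 * p.2.1 + 12 * p.2.2 = d} =>
        invMonomial t) := by
  obtain ⟨ω, h⟩ := exists_cube_root
  have hspan := weylInv_le_span h (res_mem_weylInv h (traceInv_mem_invSpace 2))
    (res_mem_weylInv h (traceInv_mem_invSpace 3)) (res_mem_weylInv h invTwelve_mem_invSpace)
    (by rw [eval_res_traceInv_two]; norm_num) res_traceInv_three_ne_zero eval_res_invTwelve
    planeRes_res_invTwelve_ne_zero (res_mem_weylInv h hf)
  have hle : Submodule.span ℂ {G | ∃ i j k, 6 * i + 9 * j + 12 * k = d ∧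
      G = res (traceInv 2) ^ i * res (traceInv 3) ^ j * res invTwelve ^ k} ≤
      (Submodule.span ℂ
        (Set.range fun t : {p : ℕ × ℕ × ℕ // 6 * p.1 + 9 * p.2.1 + 12 * p.2.2 = d} =>
          invMonomial t)).map res.toLinearMap := by
    rw [Submodule.span_le]
    rintro _ ⟨i, j, k, hd, rfl⟩
    exact ⟨_, Submodule.subset_span ⟨⟨(i, j, k), hd⟩, rfl⟩, by simp [invMonomial]⟩
  obtain ⟨g, hg, he⟩ := hle hspan
  have hg' : g ∈ invSpace 3 3 3 d := by
    refine Submodule.span_le.mpr ?_ hg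
    rintro _ ⟨⟨t, rfl⟩, rfl⟩
    exact invMonomial_mem_invSpace t
  have := eq_zero_of_res_eq_zero (sub_mem hf hg')
    (by rw [map_sub, ← AlgHom.toLinearMap_apply res g, he, sub_self])
  rwa [sub_eq_zero.mp this]

theorem finite_degree_triples (d : ℕ) :
    Finite {p : ℕ × ℕ × ℕ // 6 * p.1 + 9 * p.2.1 + 12 * p.2.2 = d} := by
  refine Set.Finite.subset ((Finset.range (d + 1)) ×ˢ (Finset.range (d + 1)) ×ˢ
    (Finset.range (d + 1))).finite_toSet fun p (hp : 6 * p.1 + 9 * p.2.1 + 12 * p.2.2 = d) => ?_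
  simp only [Finset.coe_product, Set.mem_prod, Finset.coe_range, Set.mem_Iio]
  omega

end Invariants

end TensorInvariants

/-- for the action of `SL₃(ℂ) × SL₃(ℂ) × SL₃(ℂ)` on `ℂ[x_{ijk}]`, the space of invariant polynomials homogeneous of degree `d` has dimension equal to the number of triples `(a,b,c) ∈ ℕ³` with `6a + 9b + 12c = d` (Kac: the invariant algebra is free on generators of degrees 6, 9, 12; affine Dynkin diagram `Ê₆`, generating series `1/((1-q²)(1-q³)(1-q⁴))` for `g(n³,n³,n³)`). -/
theorem stmt17 (d : ℕ) :
    Module.rank ℂ ↥(invSpace 3 3 3 d) =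
      (Nat.card {p : ℕ × ℕ × ℕ // 6 * p.1 + 9 * p.2.1 + 12 * p.2.2 = d} : Cardinal) := by
  have := TensorInvariants.finite_degree_triples d
  set v : {p : ℕ × ℕ × ℕ // 6 * p.1 + 9 * p.2.1 + 12 * p.2.2 = d} → invSpace 3 3 3 d :=
    fun t => ⟨TensorInvariants.invMonomial t, by
      have h := TensorInvariants.invMonomial_mem_invSpace t
      rwa [t.2] at h⟩
  have hli : LinearIndependent ℂ v :=
    LinearIndependent.of_comp (invSpace 3 3 3 d).subtype
      (TensorInvariants.linearIndependent_invMonomial.comp _ Subtype.val_injective)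
  have hsp : ⊤ ≤ Submodule.span ℂ (Set.range v) := by
    rintro ⟨f, hf⟩ -
    have h := TensorInvariants.invSpace_le_span hf
    have e : (Set.range fun t : {p : ℕ × ℕ × ℕ // 6 * p.1 + 9 * p.2.1 + 12 * p.2.2 = d} =>
        TensorInvariants.invMonomial t) = (invSpace 3 3 3 d).subtype '' Set.range v := by
      rw [← Set.range_comp]
      rfl
    rw [e, Submodule.span_image] at h
    obtain ⟨g, hg, rfl⟩ := h
    exact hg
  rw [Nat.cast_card]
  exact (Module.Basis.mk hli hsp).mk_eq_rank''.symm
end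
end

section
/- Let R = ℂ[x_{ijk} : i ∈ {1,2}, j ∈ {1,…,4}, k ∈ {1,…,4}] and let G = SL_2(ℂ) × SL_4(ℂ) × SL_4(ℂ) act on R by ℂ-algebra automorphisms determined by the linear substitution (g_1,g_2,g_3)·x_{ijk} = Σ_{i',j',k'} (g_1)_{i'i}(g_2)_{j'j}(g_3)_{k'k} x_{i'j'k'}. For every natural number d, the ℂ-vector space of polynomials in R that are homogeneous of degree d and fixed by every element of G has dimension equal to the number of pairs (a,b) of natural numbers with 8a + 12b = d. (By Kac's theorem the invariant algebra is free on generators of degrees 8 and 12; equivalently, the generating series of the rectangular Kronecker coefficients g((2n)^2, n^4, n^4) is Σ_n g((2n)^2,n^4,n^4) q^n = 1/((1−q^2)(1−q^3)), the case of the affine Dynkin diagram Ê_7.) -/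
noncomputable section

open MvPolynomial Matrix

/-- Every square matrix over an algebraically closed field is similar to an upper triangular one. -/
theorem exists_similar_upperTriangular {K : Type*} [Field K] [IsAlgClosed K] (n : ℕ)
    (M : Matrix (Fin n) (Fin n) K) :
    ∃ S T : Matrix (Fin n) (Fin n) K, S.det ≠ 0 ∧ (∀ i j, j < i → T i j = 0) ∧ M * S = S * T := by
  induction n with
  | zero => exact ⟨1, 1, by simp, fun i => i.elim0, by ext i; exact i.elim0⟩
  | succ n ih =>
    obtain ⟨μ, hμ⟩ := Module.End.exists_eigenvalue (Matrix.toLin' M)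
    obtain ⟨v, hv⟩ := hμ.exists_hasEigenvector
    have hMv : M *ᵥ v = μ • v := by simpa using hv.apply_eq_smul
    obtain ⟨k, hk⟩ : ∃ k, v k ≠ 0 := Function.ne_iff.1 hv.2
    obtain ⟨S₁, hS₁, hS₁v⟩ : ∃ S₁ : Matrix (Fin (n + 1)) (Fin (n + 1)) K,
        S₁.det ≠ 0 ∧ S₁ *ᵥ Pi.single 0 1 = v := by
      refine ⟨((1 : Matrix _ _ K).updateCol k v).submatrix id (Equiv.swap 0 k), ?_, ?_⟩
      · rw [Matrix.det_permute']
        have : ((1 : Matrix (Fin (n + 1)) (Fin (n + 1)) K).updateCol k v).det = v k := by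
          have := Matrix.cramer_apply (1 : Matrix (Fin (n + 1)) (Fin (n + 1)) K) v k
          rw [← this]; simp
        rw [this]
        refine mul_ne_zero ?_ hk
        rcases Int.units_eq_one_or (Equiv.Perm.sign (Equiv.swap 0 k)) with h | h <;> simp [h]
      · ext i
        simp
    have hu : IsUnit S₁.det := hS₁.isUnit
    set M₁ := S₁⁻¹ * M * S₁ with hM₁
    have hM₁S : S₁ * M₁ = M * S₁ := by
      rw [hM₁, mul_assoc, Matrix.mul_nonsing_inv_cancel_left _ _ hu]
    have hcol : ∀ i, M₁ i 0 = if i = 0 then μ else 0 := by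
      intro i
      have : M₁ *ᵥ Pi.single 0 1 = μ • Pi.single 0 1 := by
        rw [hM₁, ← Matrix.mulVec_mulVec, ← Matrix.mulVec_mulVec, hS₁v, hMv, Matrix.mulVec_smul,
          ← hS₁v, Matrix.mulVec_mulVec, Matrix.nonsing_inv_mul _ hu, Matrix.one_mulVec]
      have := congrFun this i
      simpa [Pi.single_apply] using this
    obtain ⟨S', T', hS', hT', hM'⟩ := ih (M₁.submatrix Fin.succ Fin.succ)
    let S₂ : Matrix (Fin (n + 1)) (Fin (n + 1)) K :=
      .of (Fin.cons (Fin.cons 1 0) fun i => Fin.cons 0 (S' i))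
    let T : Matrix (Fin (n + 1)) (Fin (n + 1)) K :=
      .of (Fin.cons (Fin.cons μ ((fun j => M₁ 0 j.succ) ᵥ* S')) fun i => Fin.cons 0 (T' i))
    have hS₂ : S₂.det = S'.det := by
      rw [Matrix.det_succ_row_zero, Fin.sum_univ_succ]
      simp [S₂]
      rfl
    have hM₂ : M₁ * S₂ = S₂ * T := by
      ext i j
      have h := fun i j => congrFun (congrFun hM' i) j
      simp only [Matrix.mul_apply, Matrix.submatrix_apply] at h
      refine Fin.cases ?_ (fun i => ?_) i <;> refine Fin.cases ?_ (fun j => ?_) j <;>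
        simp [Matrix.mul_apply, Fin.sum_univ_succ, S₂, T, hcol, Matrix.vecMul, dotProduct, h]
    refine ⟨S₁ * S₂, T, ?_, ?_, ?_⟩
    · rw [Matrix.det_mul, hS₂]
      exact mul_ne_zero hS₁ hS'
    · intro i j
      refine Fin.cases ?_ (fun i => ?_) i <;> refine Fin.cases ?_ (fun j => ?_) j
      · simp
      · simp
      · simp [T]
      · simpa [T] using hT' i j
    · rw [← mul_assoc, ← hM₁S, mul_assoc, hM₂, mul_assoc]

/-- The point of `ℂ² ⊗ ℂ⁴ ⊗ ℂ⁴` given by a pair of matrices. -/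
def pencil (A B : Matrix (Fin 4) (Fin 4) ℂ) : Fin 2 × Fin 4 × Fin 4 → ℂ :=
  fun v => ![A, B] v.1 v.2.1 v.2.2

theorem exists_eq_pencil (x : Fin 2 × Fin 4 × Fin 4 → ℂ) : ∃ A B, x = pencil A B := by
  refine ⟨.of fun i j => x (0, i, j), .of fun i j => x (1, i, j), ?_⟩
  ext ⟨i, j, k⟩
  fin_cases i <;> simp [pencil]

theorem eval_act {n₁ n₂ n₃ : ℕ}
    (g : Matrix.SpecialLinearGroup (Fin n₁) ℂ × Matrix.SpecialLinearGroup (Fin n₂) ℂ ×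
      Matrix.SpecialLinearGroup (Fin n₃) ℂ)
    (x : Fin n₁ × Fin n₂ × Fin n₃ → ℂ) (f : MvPolynomial (Fin n₁ × Fin n₂ × Fin n₃) ℂ) :
    eval x (act n₁ n₂ n₃ g f) =
      eval (fun v => ∑ w : Fin n₁ × Fin n₂ × Fin n₃,
        g.1.val w.1 v.1 * g.2.1.val w.2.1 v.2.1 * g.2.2.val w.2.2 v.2.2 * x w) f := by
  have : (aeval x).comp (act n₁ n₂ n₃ g) =
      aeval (fun v => ∑ w : Fin n₁ × Fin n₂ × Fin n₃,
        g.1.val w.1 v.1 * g.2.1.val w.2.1 v.2.1 * g.2.2.val w.2.2 v.2.2 * x w) := by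
    apply MvPolynomial.algHom_ext
    intro v
    simp [act]
  simpa [MvPolynomial.coe_aeval_eq_eval] using congrArg (fun F => F f) this

theorem eval_pencil_act
    (g : Matrix.SpecialLinearGroup (Fin 2) ℂ × Matrix.SpecialLinearGroup (Fin 4) ℂ ×
      Matrix.SpecialLinearGroup (Fin 4) ℂ)
    (A B : Matrix (Fin 4) (Fin 4) ℂ) (f : MvPolynomial (Fin 2 × Fin 4 × Fin 4) ℂ) :
    eval (pencil A B) (act 2 4 4 g f) =
      eval (pencil
        (g.2.1.valᵀ * (g.1.val 0 0 • A + g.1.val 1 0 • B) * g.2.2.val)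
        (g.2.1.valᵀ * (g.1.val 0 1 • A + g.1.val 1 1 • B) * g.2.2.val)) f := by
  rw [eval_act]
  congr 2
  ext ⟨i, j, k⟩
  have key : ∀ a b : ℂ, ((g.2.1.valᵀ * (a • A + b • B) * g.2.2.val) j k) =
      ∑ j', ∑ k', (a * A j' k' + b * B j' k') * g.2.1.val j' j * g.2.2.val k' k := by
    intro a b
    simp only [Matrix.mul_apply, Finset.sum_mul]
    rw [Finset.sum_comm]
    refine Finset.sum_congr rfl fun _ _ => Finset.sum_congr rfl fun _ _ => ?_
    simp only [Matrix.transpose_apply, Matrix.add_apply, Matrix.smul_apply, smul_eq_mul]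
    ring
  simp only [Fintype.sum_prod_type, Fin.sum_univ_two, ← Finset.sum_add_distrib]
  fin_cases i <;> simp only [pencil, Fin.zero_eta, Fin.mk_one, Matrix.cons_val_zero,
      Matrix.cons_val_one, key] <;>
    exact Finset.sum_congr rfl fun _ _ => Finset.sum_congr rfl fun _ _ => by ring

/-- The coefficient of `s ^ (4 - k) * t ^ k` in `det (s • A + t • B)`. -/
def pencilCoeff {R : Type*} [CommRing R] (k : ℕ) (A B : Matrix (Fin 4) (Fin 4) R) : R :=
  ∑ S ∈ Finset.powersetCard k (Finset.univ : Finset (Fin 4)),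
    (Matrix.of fun i j => if i ∈ S then B i j else A i j).det

theorem det_smul_add_smul {R : Type*} [CommRing R] (s t : R) (A B : Matrix (Fin 4) (Fin 4) R) :
    (s • A + t • B).det = ∑ k ∈ Finset.range 5, t ^ k * s ^ (4 - k) * pencilCoeff k A B := by
  have h := (Matrix.detRowAlternating (n := Fin 4) (R := R)).toMultilinearMap.map_add_univ
    (fun i => t • B i) (fun i => s • A i)
  have h₂ : (s • A + t • B).det = ∑ S : Finset (Fin 4),
      (Matrix.of fun i j => (if i ∈ S then t else s) * (if i ∈ S then B i j else A i j)).det := by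
    rw [add_comm]
    refine h.trans (Finset.sum_congr rfl fun S _ => ?_)
    change Matrix.det _ = _
    congr 1
    ext i j
    by_cases hi : i ∈ S <;> simp [Finset.piecewise, hi]
  rw [h₂, ← Finset.powerset_univ, Finset.sum_powerset]
  refine Finset.sum_congr (by simp) fun k _ => ?_
  rw [pencilCoeff, Finset.mul_sum]
  refine Finset.sum_congr rfl fun S hS => ?_
  rw [Finset.mem_powersetCard] at hS
  have := Matrix.det_mul_column (fun i => if i ∈ S then t else s)
    (Matrix.of fun i j => if i ∈ S then B i j else A i j)
  simp only [Matrix.of_apply] at this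
  rw [this, Finset.prod_ite]
  simp [hS.2, Finset.filter_not, Finset.card_sdiff]

theorem map_pencilCoeff {R S : Type*} [CommRing R] [CommRing S] (f : R →+* S) (k : ℕ)
    (A B : Matrix (Fin 4) (Fin 4) R) :
    f (pencilCoeff k A B) = pencilCoeff k (A.map f) (B.map f) := by
  simp only [pencilCoeff, map_sum, RingHom.map_det]
  refine Finset.sum_congr rfl fun S _ => congrArg _ ?_
  ext i j
  by_cases hi : i ∈ S <;> simp [hi]

/-- The degree 2 invariant of a binary quartic with coefficients `c 0, …, c 4`. -/
def quarticI {R : Type*} [CommRing R] (c : ℕ → R) : R :=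
  12 * c 0 * c 4 - 3 * c 1 * c 3 + c 2 ^ 2

/-- The degree 3 invariant of a binary quartic with coefficients `c 0, …, c 4`. -/
def quarticJ {R : Type*} [CommRing R] (c : ℕ → R) : R :=
  72 * c 0 * c 2 * c 4 + 9 * c 1 * c 2 * c 3 - 27 * c 0 * c 3 ^ 2 - 27 * c 4 * c 1 ^ 2 - 2 * c 2 ^ 3

theorem quartic_coeff_unique {c e : ℕ → ℂ}
    (h : ∀ t : ℂ, ∑ k ∈ Finset.range 5, t ^ k * c k = ∑ k ∈ Finset.range 5, t ^ k * e k) :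
    c 0 = e 0 ∧ c 1 = e 1 ∧ c 2 = e 2 ∧ c 3 = e 3 ∧ c 4 = e 4 := by
  have h0 := h 0
  have h1 := h 1
  have h2 := h (-1)
  have h3 := h 2
  have h4 := h (-2)
  simp only [Finset.sum_range_succ, Finset.sum_range_zero] at h0 h1 h2 h3 h4
  norm_num at h0 h1 h2 h3 h4
  refine ⟨h0, ?_, ?_, ?_, ?_⟩
  · linear_combination (2 / 3 : ℂ) * h1 - 2 / 3 * h2 - 1 / 12 * h3 + 1 / 12 * h4
  · linear_combination (-5 / 4 : ℂ) * h0 + 2 / 3 * h1 + 2 / 3 * h2 - 1 / 24 * h3 - 1 / 24 * h4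
  · linear_combination (-1 / 6 : ℂ) * h1 + 1 / 6 * h2 + 1 / 12 * h3 - 1 / 12 * h4
  · linear_combination (1 / 4 : ℂ) * h0 - 1 / 6 * h1 - 1 / 6 * h2 + 1 / 24 * h3 + 1 / 24 * h4

theorem quartic_invariants_substitution {c e : ℕ → ℂ} {x y z w : ℂ} (hdet : x * w - y * z = 1)
    (h : ∀ t : ℂ, ∑ k ∈ Finset.range 5, t ^ k * e k =
      ∑ k ∈ Finset.range 5, (y + t * w) ^ k * (x + t * z) ^ (4 - k) * c k) :
    quarticI e = quarticI c ∧ quarticJ e = quarticJ c := by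
  obtain ⟨h0, h1, h2, h3, h4⟩ := quartic_coeff_unique (c := e)
    (e := fun k => [
      x ^ 4 * c 0 + x ^ 3 * y * c 1 + x ^ 2 * y ^ 2 * c 2 + x * y ^ 3 * c 3 + y ^ 4 * c 4,
      4 * x ^ 3 * z * c 0 + (3 * x ^ 2 * z * y + x ^ 3 * w) * c 1 +
        (2 * x * z * y ^ 2 + 2 * x ^ 2 * y * w) * c 2 +
        (z * y ^ 3 + 3 * x * y ^ 2 * w) * c 3 + 4 * y ^ 3 * w * c 4,
      6 * x ^ 2 * z ^ 2 * c 0 + (3 * x * z ^ 2 * y + 3 * x ^ 2 * z * w) * c 1 +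
        (z ^ 2 * y ^ 2 + 4 * x * z * y * w + x ^ 2 * w ^ 2) * c 2 +
        (3 * z * y ^ 2 * w + 3 * x * y * w ^ 2) * c 3 + 6 * y ^ 2 * w ^ 2 * c 4,
      4 * x * z ^ 3 * c 0 + (z ^ 3 * y + 3 * x * z ^ 2 * w) * c 1 +
        (2 * z ^ 2 * y * w + 2 * x * z * w ^ 2) * c 2 +
        (3 * z * y * w ^ 2 + x * w ^ 3) * c 3 + 4 * y * w ^ 3 * c 4,
      z ^ 4 * c 0 + z ^ 3 * w * c 1 + z ^ 2 * w ^ 2 * c 2 + z * w ^ 3 * c 3 + w ^ 4 * c 4].getD k 0) fun t => by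
      rw [h t]
      simp only [Finset.sum_range_succ, Finset.sum_range_zero, List.getD_cons_zero,
        List.getD_cons_succ]
      ring
  simp only [List.getD_cons_zero, List.getD_cons_succ] at h0 h1 h2 h3 h4
  constructor
  · have : quarticI e = (x * w - y * z) ^ 4 * quarticI c := by
      simp only [quarticI, h0, h1, h2, h3, h4]
      ring
    rw [this, hdet, one_pow, one_mul]
  · have : quarticJ e = (x * w - y * z) ^ 6 * quarticJ c := by
      simp only [quarticJ, h0, h1, h2, h3, h4]
      ring
    rw [this, hdet, one_pow, one_mul]

theorem det_eq_one_pencil_invariants {A B A' B' P Q : Matrix (Fin 4) (Fin 4) ℂ} {x y z w : ℂ}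
    (hdet : x * w - y * z = 1) (hPQ : P.det * Q.det = 1)
    (hA : A' = P * (x • A + y • B) * Q) (hB : B' = P * (z • A + w • B) * Q) :
    quarticI (fun k => pencilCoeff k A' B') = quarticI (fun k => pencilCoeff k A B) ∧
      quarticJ (fun k => pencilCoeff k A' B') = quarticJ (fun k => pencilCoeff k A B) := by
  refine quartic_invariants_substitution hdet fun t => ?_
  rw [← det_smul_add_smul]
  have h := det_smul_add_smul 1 t A' B'
  simp only [one_pow, mul_one] at h
  rw [← h]
  have : (1 : ℂ) • A' + t • B' = P * ((x + t * z) • A + (y + t * w) • B) * Q := by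
    rw [hA, hB]
    simp only [smul_add, mul_add, add_mul, Matrix.mul_smul, Matrix.smul_mul, add_smul, mul_smul,
      one_smul]
    abel
  rw [this, Matrix.det_mul, Matrix.det_mul]
  linear_combination ((x + t * z) • A + (y + t * w) • B).det * hPQ

/-- The generic matrix with entries the variables `x_{ijk}`, for fixed `i`. -/
def genericSlice (i : Fin 2) :
    Matrix (Fin 4) (Fin 4) (MvPolynomial (Fin 2 × Fin 4 × Fin 4) ℂ) :=
  .of fun j k => X (i, j, k)

/-- The two generators of the invariant algebra, of degrees 8 and 12. -/
def generator : Fin 2 → MvPolynomial (Fin 2 × Fin 4 × Fin 4) ℂ :=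
  ![quarticI fun k => pencilCoeff k (genericSlice 0) (genericSlice 1),
    quarticJ fun k => pencilCoeff k (genericSlice 0) (genericSlice 1)]

theorem eval_pencilCoeff (A B : Matrix (Fin 4) (Fin 4) ℂ) (k : ℕ) :
    eval (pencil A B) (pencilCoeff k (genericSlice 0) (genericSlice 1)) = pencilCoeff k A B := by
  rw [map_pencilCoeff]
  congr 1 <;>
  · ext i j
    simp [genericSlice, pencil]

theorem eval_generator_zero (A B : Matrix (Fin 4) (Fin 4) ℂ) :
    eval (pencil A B) (generator 0) = quarticI fun k => pencilCoeff k A B := by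
  simp [generator, quarticI, eval_pencilCoeff]

theorem eval_generator_one (A B : Matrix (Fin 4) (Fin 4) ℂ) :
    eval (pencil A B) (generator 1) = quarticJ fun k => pencilCoeff k A B := by
  simp [generator, quarticJ, eval_pencilCoeff]

theorem act_generator
    (g : Matrix.SpecialLinearGroup (Fin 2) ℂ × Matrix.SpecialLinearGroup (Fin 4) ℂ ×
      Matrix.SpecialLinearGroup (Fin 4) ℂ) (i : Fin 2) :
    act 2 4 4 g (generator i) = generator i := by
  apply MvPolynomial.funext
  intro x
  obtain ⟨A, B, rfl⟩ := exists_eq_pencil x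
  have hg : g.1.val 0 0 * g.1.val 1 1 - g.1.val 1 0 * g.1.val 0 1 = 1 := by
    have := g.1.2
    rw [Matrix.det_fin_two] at this
    linear_combination this
  have h := det_eq_one_pencil_invariants (A := A) (B := B) (P := g.2.1.valᵀ) (Q := g.2.2.val)
    hg (by simp) rfl rfl
  rw [eval_pencil_act]
  fin_cases i
  · exact (eval_generator_zero _ _).trans (h.1.trans (eval_generator_zero _ _).symm)
  · exact (eval_generator_one _ _).trans (h.2.trans (eval_generator_one _ _).symm)

theorem isHomogeneous_pencilCoeff (k : ℕ) :
    (pencilCoeff k (genericSlice 0) (genericSlice 1)).IsHomogeneous 4 := by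
  refine IsHomogeneous.sum _ _ _ fun S _ => ?_
  rw [Matrix.det_apply]
  refine IsHomogeneous.sum _ _ _ fun σ _ => ?_
  have h : (∏ i, (Matrix.of fun i j => if i ∈ S then genericSlice 1 i j
      else genericSlice 0 i j) (σ i) i).IsHomogeneous (∑ _i : Fin 4, 1) := by
    refine IsHomogeneous.prod _ _ _ fun i _ => ?_
    by_cases hi : σ i ∈ S <;> simp [hi, genericSlice, isHomogeneous_X]
  rcases Int.units_eq_one_or (Equiv.Perm.sign σ) with hσ | hσ
  · simpa [hσ] using h
  · simpa [hσ] using h.neg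

theorem isHomogeneous_generator_zero : (generator 0).IsHomogeneous 8 := by
  have h := isHomogeneous_pencilCoeff
  have h3 := isHomogeneous_C (Fin 2 × Fin 4 × Fin 4) (3 : ℂ)
  have h12 := isHomogeneous_C (Fin 2 × Fin 4 × Fin 4) (12 : ℂ)
  exact (((h12.mul (h 0)).mul (h 4)).sub ((h3.mul (h 1)).mul (h 3))).add ((h 2).pow 2)

theorem isHomogeneous_generator_one : (generator 1).IsHomogeneous 12 := by
  have h := isHomogeneous_pencilCoeff
  have hC := isHomogeneous_C (R := ℂ) (Fin 2 × Fin 4 × Fin 4)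
  exact ((((((hC 72).mul (h 0)).mul (h 2)).mul (h 4)).add
    ((((hC 9).mul (h 1)).mul (h 2)).mul (h 3))).sub
    (((hC 27).mul (h 0)).mul ((h 3).pow 2))).sub
    (((hC 27).mul (h 4)).mul ((h 1).pow 2)) |>.sub ((hC 2).mul ((h 2).pow 3))

theorem eval_pencil_mul {f : MvPolynomial (Fin 2 × Fin 4 × Fin 4) ℂ}
    (hf : ∀ g, act 2 4 4 g f = f)
    {P Q : Matrix (Fin 4) (Fin 4) ℂ} (hPQ : P.det * Q.det = 1)
    (A B : Matrix (Fin 4) (Fin 4) ℂ) :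
    eval (pencil (P * A * Q) (P * B * Q)) f = eval (pencil A B) f := by
  have hP : P.det ≠ 0 := left_ne_zero_of_mul_eq_one hPQ
  obtain ⟨c, hc⟩ := IsAlgClosed.exists_pow_nat_eq (P.det)⁻¹ (n := 4) (by norm_num)
  have hc0 : c ≠ 0 := by
    rintro rfl
    exact inv_ne_zero hP (by simpa using hc.symm)
  have h := eval_pencil_act (1, ⟨(c • P)ᵀ, by simp [hc, hP]⟩,
    ⟨c⁻¹ • Q, by simp [hc, hPQ]⟩) A B f
  rw [hf] at h
  rw [h]
  simp [smul_smul, hc0]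

theorem eval_pencil_intertwine {f : MvPolynomial (Fin 2 × Fin 4 × Fin 4) ℂ}
    (hf : ∀ g, act 2 4 4 g f = f)
    {P Q A B A' B' : Matrix (Fin 4) (Fin 4) ℂ} (hP : P.det ≠ 0)
    (hPQ : P.det = Q.det) (hA : P * A = A' * Q) (hB : P * B = B' * Q) :
    eval (pencil A' B') f = eval (pencil A B) f := by
  have hQ : IsUnit Q.det := (hPQ ▸ hP).isUnit
  rw [← eval_pencil_mul hf (P := P) (Q := Q⁻¹) (by
    rw [hPQ, Matrix.det_nonsing_inv, Ring.mul_inverse_cancel _ hQ]) A B, hA, hB,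
    Matrix.mul_nonsing_inv_cancel_right _ _ hQ, Matrix.mul_nonsing_inv_cancel_right _ _ hQ]

theorem eval_pencil_substitution {f : MvPolynomial (Fin 2 × Fin 4 × Fin 4) ℂ}
    (hf : ∀ g, act 2 4 4 g f = f)
    {x y z w : ℂ} (h : x * w - y * z = 1)
    (A B : Matrix (Fin 4) (Fin 4) ℂ) :
    eval (pencil (x • A + y • B) (z • A + w • B)) f = eval (pencil A B) f := by
  have h := eval_pencil_act (⟨!![x, z; y, w], by
    rw [Matrix.det_fin_two_of]; linear_combination h⟩, 1, 1) A B f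
  rw [hf] at h
  rw [h]
  simp

/-- An invariant takes the same value on an upper triangular pencil and on its diagonal, since the
latter is a limit of pencils conjugate to the former. -/
theorem eval_pencil_upperTriangular {f : MvPolynomial (Fin 2 × Fin 4 × Fin 4) ℂ}
    (hf : ∀ g, act 2 4 4 g f = f)
    {A B : Matrix (Fin 4) (Fin 4) ℂ}
    (hA : ∀ i j, j < i → A i j = 0) (hB : ∀ i j, j < i → B i j = 0) :
    eval (pencil A B) f = eval (pencil (diagonal fun i => A i i) (diagonal fun i => B i i)) f := by
  let D (M : Matrix (Fin 4) (Fin 4) ℂ) (ε : ℂ) : Matrix (Fin 4) (Fin 4) ℂ :=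
    .of fun i j => M i j * ε ^ ((j : ℕ) - i)
  have hclosed : IsClosed {ε : ℂ | eval (pencil (D A ε) (D B ε)) f = eval (pencil A B) f} := by
    refine isClosed_eq ?_ continuous_const
    refine (MvPolynomial.continuous_eval f).comp (continuous_pi ?_)
    rintro ⟨i, j, k⟩
    fin_cases i <;> simp only [pencil, D] <;> simp <;> fun_prop
  have hD : ∀ ε : ℂ, ε ≠ 0 → ∀ M : Matrix (Fin 4) (Fin 4) ℂ, (∀ i j, j < i → M i j = 0) →
      diagonal (fun i : Fin 4 => ε ^ (i : ℕ)) * D M ε =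
        M * diagonal (fun i : Fin 4 => ε ^ (i : ℕ)) := by
    intro ε _ M hM
    ext i j
    rw [Matrix.diagonal_mul, Matrix.mul_diagonal]
    rcases lt_or_ge j i with hij | hij
    · simp [D, hM i j hij]
    · simp only [D, Matrix.of_apply]
      rw [mul_left_comm, ← pow_add, Nat.add_sub_cancel' (by exact_mod_cast hij)]
  have hsub : ({0}ᶜ : Set ℂ) ⊆ {ε : ℂ | eval (pencil (D A ε) (D B ε)) f = eval (pencil A B) f} := by
    intro ε hε
    have hε : ε ≠ 0 := hε
    refine (eval_pencil_intertwine hf (Matrix.det_diagonal.trans_ne ?_) rfl (hD ε hε A hA)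
      (hD ε hε B hB)).symm
    exact Finset.prod_ne_zero_iff.2 fun i _ => pow_ne_zero _ hε
  have h0 : (0 : ℂ) ∈ {ε : ℂ | eval (pencil (D A ε) (D B ε)) f = eval (pencil A B) f} := by
    have := (dense_compl_singleton (0 : ℂ)).mono hsub
    rw [← hclosed.closure_eq, this.closure_eq]
    trivial
  have hdiag : ∀ M : Matrix (Fin 4) (Fin 4) ℂ, (∀ i j, j < i → M i j = 0) →
      D M 0 = diagonal fun i => M i i := by
    intro M hM
    ext i j
    rcases lt_trichotomy j i with hij | rfl | hij
    · simp [D, hM i j hij, hij.ne']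
    · simp [D]
    · have : (j : ℕ) - i ≠ 0 := Nat.sub_ne_zero_of_lt hij
      simp [D, hij.ne, this]
  rw [← hdiag A hA, ← hdiag B hB]
  exact h0.symm

/-- A point of the two-parameter family of pencils with
`det (s • A + t • B) = t * (s ^ 3 + p * s * t ^ 2 + r * t ^ 3)`. -/
def sectionPoint (p r : ℂ) : Fin 2 × Fin 4 × Fin 4 → ℂ :=
  pencil (diagonal ![1, 1, 1, 0]) !![0, 1, 0, 0; 0, 0, 1, 0; r, -p, 0, 0; 0, 0, 0, 1]

theorem eval_normalized_diagonal_eq_zero {f : MvPolynomial (Fin 2 × Fin 4 × Fin 4) ℂ}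
    (hf : ∀ g, act 2 4 4 g f = f) (hs : ∀ p r, eval (sectionPoint p r) f = 0)
    (z : Fin 3 → ℂ) (hz : z 0 + z 1 + z 2 = 0) :
    eval (pencil (diagonal ![1, 1, 1, 0]) (diagonal ![z 0, z 1, z 2, 1])) f = 0 := by
  obtain ⟨p, hp⟩ : ∃ p, p = z 0 * z 1 + z 0 * z 2 + z 1 * z 2 := ⟨_, rfl⟩
  obtain ⟨r, hr⟩ : ∃ r, r = z 0 * z 1 * z 2 := ⟨_, rfl⟩
  have hz2 : z 2 = -(z 0 + z 1) := by linear_combination hz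
  have h₁ := eval_pencil_upperTriangular hf
    (A := diagonal ![1, 1, 1, 0])
    (B := !![z 0, 1, 0, 0; 0, z 1, 1, 0; 0, 0, z 2, 0; 0, 0, 0, 1])
    (fun i j hij => diagonal_apply_ne _ hij.ne')
    (fun i j hij => by fin_cases i <;> fin_cases j <;> simp at hij ⊢)
  have h₂ := eval_pencil_intertwine hf
    (P := !![1, 0, 0, 0; z 0, 1, 0, 0; z 0 ^ 2, z 0 + z 1, 1, 0; 0, 0, 0, 1])
    (Q := !![1, 0, 0, 0; z 0, 1, 0, 0; z 0 ^ 2, z 0 + z 1, 1, 0; 0, 0, 0, 1])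
    (A := diagonal ![1, 1, 1, 0])
    (B := !![z 0, 1, 0, 0; 0, z 1, 1, 0; 0, 0, z 2, 0; 0, 0, 0, 1])
    (A' := diagonal ![1, 1, 1, 0])
    (B' := !![0, 1, 0, 0; 0, 0, 1, 0; r, -p, 0, 0; 0, 0, 0, 1])
    (by simp [Matrix.det_succ_row_zero, Fin.sum_univ_succ, Fin.succAbove]) rfl
    (by
      ext i j
      rw [Matrix.mul_diagonal, Matrix.diagonal_mul]
      fin_cases i <;> fin_cases j <;> simp)
    (by
      ext i j
      fin_cases i <;> fin_cases j <;>
        simp [Matrix.mul_apply, Fin.sum_univ_succ, hp, hr, hz2] <;> ring)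
  have h₃ := h₁.symm.trans (h₂.symm.trans (hs p r))
  convert h₃ using 4 <;>
  · ext i j
    fin_cases i <;> simp [Matrix.diagonal]

theorem eval_generic_diagonal_eq_zero {f : MvPolynomial (Fin 2 × Fin 4 × Fin 4) ℂ}
    (hf : ∀ g, act 2 4 4 g f = f) (hs : ∀ p r, eval (sectionPoint p r) f = 0)
    (a b : Fin 4 → ℂ) (hb : b 3 ≠ 0)
    (hα : ∀ i : Fin 3, a i.castSucc * b 3 - b i.castSucc * a 3 ≠ 0) :
    eval (pencil (diagonal a) (diagonal b)) f = 0 := by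
  obtain ⟨α, hαdef⟩ : ∃ α : Fin 3 → ℂ, ∀ i, α i = a i.castSucc * b 3 - b i.castSucc * a 3 :=
    ⟨_, fun _ => rfl⟩
  simp only [← hαdef] at hα
  have hα0 := hα 0
  have hα1 := hα 1
  have hα2 := hα 2
  obtain ⟨k, hk⟩ := IsAlgClosed.exists_pow_nat_eq (α 0 * α 1 * α 2)⁻¹ (n := 2) (by norm_num)
  have hk0 : k ≠ 0 := by
    rintro rfl
    have : (α 0 * α 1 * α 2)⁻¹ ≠ 0 := by positivity
    exact this (by simpa using hk.symm)
  obtain ⟨y, hy⟩ : ∃ y : Fin 3 → ℂ, ∀ i, y i = b i.castSucc / (k ^ 2 * b 3 * α i) :=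
    ⟨_, fun _ => rfl⟩
  obtain ⟨m, hm⟩ : ∃ m, m = -(y 0 + y 1 + y 2) / 3 := ⟨_, rfl⟩
  have h₁ := eval_normalized_diagonal_eq_zero hf hs (fun i => y i + m) (by rw [hm]; ring)
  have h₂ := eval_pencil_substitution hf (x := k * b 3) (y := -k * a 3) (z := m * (k * b 3))
    (w := 1 / (k * b 3) + m * (-k * a 3)) (by field_simp; ring) (diagonal a) (diagonal b)
  have h₃ := eval_pencil_mul hf (P := diagonal ![1 / (k * α 0), 1 / (k * α 1), 1 / (k * α 2), k])
    (Q := 1) (by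
      simp only [Matrix.det_diagonal, Fin.prod_univ_four, Matrix.det_one]
      simp
      field_simp
      rw [hk]
      field_simp)
    ((k * b 3) • diagonal a + (-k * a 3) • diagonal b)
    ((m * (k * b 3)) • diagonal a + (1 / (k * b 3) + m * (-k * a 3)) • diagonal b)
  rw [← h₂, ← h₃, ← h₁]
  have e0 := hαdef 0
  have e1 := hαdef 1
  have e2 := hαdef 2
  have y0 := hy 0
  have y1 := hy 1
  have y2 := hy 2
  simp only [Fin.castSucc_zero, Fin.castSucc_one, show (2 : Fin 3).castSucc = 2 from rfl] at *
  congr 3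
  · simp only [← Matrix.diagonal_smul, Matrix.diagonal_add, Matrix.diagonal_mul_diagonal, mul_one]
    congr 1
    ext i
    fin_cases i <;> simp
    · field_simp; rw [e0]; ring
    · field_simp; rw [e1]; ring
    · field_simp; rw [e2]; ring
    · right; ring
  · simp only [← Matrix.diagonal_smul, Matrix.diagonal_add, Matrix.diagonal_mul_diagonal, mul_one]
    congr 1
    ext i
    fin_cases i <;> simp
    · rw [y0]; field_simp; rw [e0]; ring
    · rw [y1]; field_simp; rw [e1]; ring
    · rw [y2]; field_simp; rw [e2]; ring
    · field_simp; ring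

theorem eval_diagonal_eq_zero {f : MvPolynomial (Fin 2 × Fin 4 × Fin 4) ℂ}
    (hf : ∀ g, act 2 4 4 g f = f) (hs : ∀ p r, eval (sectionPoint p r) f = 0)
    (a b : Fin 4 → ℂ) :
    eval (pencil (diagonal a) (diagonal b)) f = 0 := by
  let F : MvPolynomial (Fin 2 × Fin 4) ℂ :=
    aeval (fun v => if v.2.1 = v.2.2 then X (v.1, v.2.1) else 0) f
  let N : MvPolynomial (Fin 2 × Fin 4) ℂ :=
    X (1, 3) * ∏ i : Fin 3, (X (0, i.castSucc) * X (1, 3) - X (1, i.castSucc) * X (0, 3))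
  have hF : ∀ a b : Fin 4 → ℂ, eval (fun v => ![a, b] v.1 v.2) F =
      eval (pencil (diagonal a) (diagonal b)) f := by
    intro a b
    simp only [F]
    rw [← MvPolynomial.coe_aeval_eq_eval, ← MvPolynomial.coe_aeval_eq_eval]
    change (aeval _ : _ →ₐ[ℂ] ℂ) (aeval _ f) = (aeval _ : _ →ₐ[ℂ] ℂ) f
    rw [← AlgHom.comp_apply, MvPolynomial.comp_aeval]
    congr 2
    ext ⟨i, j, k⟩
    by_cases hjk : j = k <;> fin_cases i <;> simp [pencil, hjk, diagonal]
  have hN : N ≠ 0 := by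
    intro h
    have := congrArg (eval (fun v => ![![1, 1, 1, 0], ![0, 0, 0, (1 : ℂ)]] v.1 v.2)) h
    simp [N, Fin.prod_univ_succ] at this
  have hFN : F * N = 0 := by
    apply MvPolynomial.funext
    intro x
    have hx : x = fun v => ![fun j => x (0, j), fun j => x (1, j)] v.1 v.2 := by
      ext ⟨i, j⟩
      fin_cases i <;> simp
    rw [map_zero, map_mul, mul_eq_zero, or_iff_not_imp_right]
    intro hN
    rw [hx, hF]
    simp only [N, map_mul, map_prod, map_sub, eval_X] at hN
    exact eval_generic_diagonal_eq_zero hf hs _ _ (left_ne_zero_of_mul hN)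
      fun i => Finset.prod_ne_zero_iff.1 (right_ne_zero_of_mul hN) i (Finset.mem_univ i)
  rw [← hF, (mul_eq_zero.1 hFN).resolve_right hN, map_zero]

theorem eval_pencil_eq_zero_of_det_ne_zero {f : MvPolynomial (Fin 2 × Fin 4 × Fin 4) ℂ}
    (hf : ∀ g, act 2 4 4 g f = f) (hs : ∀ p r, eval (sectionPoint p r) f = 0)
    {A B : Matrix (Fin 4) (Fin 4) ℂ} (hA : A.det ≠ 0) :
    eval (pencil A B) f = 0 := by
  obtain ⟨S, T, hS, hT, hST⟩ := exists_similar_upperTriangular 4 (A⁻¹ * B)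
  obtain ⟨k, hk⟩ := IsAlgClosed.exists_pow_nat_eq A.det (n := 4) (by norm_num)
  have hk0 : k ≠ 0 := by
    rintro rfl
    exact hA (by simpa using hk.symm)
  have hBS : A * S * T = B * S := by
    rw [mul_assoc, ← hST, mul_assoc, Matrix.mul_nonsing_inv_cancel_left _ _ hA.isUnit]
  have hdet : (k⁻¹ • (A * S)).det = S.det := by
    simp [hk, hA]
  have h₁ := eval_pencil_intertwine hf (P := k⁻¹ • (A * S)) (Q := S) (A := diagonal fun _ => k)
    (B := k • T) (A' := A) (B' := B) (by rwa [hdet]) hdet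
    (by
      have : (diagonal fun _ => k : Matrix (Fin 4) (Fin 4) ℂ) = k • 1 := by
        rw [Matrix.smul_one_eq_diagonal]
      rw [this]
      simp [hk0, smul_smul])
    (by simp [hk0, smul_smul, hBS])
  rw [h₁, eval_pencil_upperTriangular hf (fun i j hij => diagonal_apply_ne _ hij.ne')
    (fun i j hij => by simp [hT i j hij])]
  exact eval_diagonal_eq_zero hf hs _ _

/-- An invariant is determined by its values on the two-parameter section. -/
theorem eq_zero_of_eval_sectionPoint {f : MvPolynomial (Fin 2 × Fin 4 × Fin 4) ℂ}
    (hf : ∀ g, act 2 4 4 g f = f) (hs : ∀ p r, eval (sectionPoint p r) f = 0) :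
    f = 0 := by
  have hmap : ∀ A B, (genericSlice 0).map (eval (pencil A B)) = A := by
    intro A B
    ext i j
    simp [genericSlice, pencil]
  have hdet : ∀ A B, eval (pencil A B) (genericSlice 0).det = A.det := by
    intro A B
    rw [RingHom.map_det, RingHom.mapMatrix_apply, hmap]
  have hN : (genericSlice 0).det ≠ 0 := by
    intro h
    have := hdet 1 0
    rw [h] at this
    simp at this
  have : f * (genericSlice 0).det = 0 := by
    apply MvPolynomial.funext
    intro x
    obtain ⟨A, B, rfl⟩ := exists_eq_pencil x
    rw [map_zero, map_mul, mul_eq_zero, or_iff_not_imp_right, hdet]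
    exact eval_pencil_eq_zero_of_det_ne_zero hf hs
  exact (mul_eq_zero.1 this).resolve_right hN

theorem eval_sectionPoint_generator (p r : ℂ) :
    eval (sectionPoint p r) (generator 0) = -3 * p ∧
      eval (sectionPoint p r) (generator 1) = -27 * r := by
  obtain ⟨h0, h1, h2, h3, h4⟩ := quartic_coeff_unique
    (c := fun k => pencilCoeff k (diagonal ![1, 1, 1, 0])
      !![0, 1, 0, 0; 0, 0, 1, 0; r, -p, 0, 0; 0, 0, 0, 1])
    (e := fun k => [0, 1, 0, p, r].getD k 0) fun t => by
      have h := det_smul_add_smul 1 t (diagonal ![1, 1, 1, 0])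
        !![0, 1, 0, 0; 0, 0, 1, 0; r, -p, 0, 0; 0, 0, 0, 1]
      simp only [one_pow, mul_one] at h
      have hM : (1 : ℂ) • diagonal ![1, 1, 1, 0] +
          t • !![0, 1, 0, 0; 0, 0, 1, 0; r, -p, 0, 0; 0, 0, 0, 1] =
          !![1, t, 0, 0; 0, 1, t, 0; t * r, -(t * p), 1, 0; 0, 0, 0, t] := by
        ext i j
        fin_cases i <;> fin_cases j <;> simp
      rw [← h, hM]
      simp [Matrix.det_succ_row_zero, Fin.sum_univ_succ, Fin.succAbove, Finset.sum_range_succ]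
      ring
  simp only [List.getD_cons_zero, List.getD_cons_succ] at h0 h1 h2 h3 h4
  rw [sectionPoint, eval_generator_zero, eval_generator_one]
  simp only [quarticI, quarticJ, h0, h1, h2, h3, h4]
  constructor <;> ring

/-- Restriction of polynomials to the section, in coordinates where the generators restrict to the
variables. -/
def restrict : MvPolynomial (Fin 2 × Fin 4 × Fin 4) ℂ →ₐ[ℂ] MvPolynomial (Fin 2) ℂ :=
  aeval fun v => (![diagonal ![1, 1, 1, 0], !![0, 1, 0, 0; 0, 0, 1, 0;
    C (-1 / 27) * X 1, C (1 / 3) * X 0, 0, 0; 0, 0, 0, 1]] v.1 v.2.1 v.2.2 : MvPolynomial (Fin 2) ℂ)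

theorem eval_restrict (y : Fin 2 → ℂ) (f : MvPolynomial (Fin 2 × Fin 4 × Fin 4) ℂ) :
    eval y (restrict f) = eval (sectionPoint (-1 / 3 * y 0) (-1 / 27 * y 1)) f := by
  rw [← MvPolynomial.coe_aeval_eq_eval, ← MvPolynomial.coe_aeval_eq_eval]
  change (aeval _ : _ →ₐ[ℂ] ℂ) (aeval _ f) = (aeval _ : _ →ₐ[ℂ] ℂ) f
  rw [← AlgHom.comp_apply, MvPolynomial.comp_aeval]
  congr 2
  ext ⟨i, j, k⟩
  fin_cases i
  · by_cases h : j = k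
    · subst h
      fin_cases j <;> simp [sectionPoint, pencil]
    · simp [sectionPoint, pencil, h]
  · fin_cases j <;> fin_cases k <;> simp [sectionPoint, pencil]
    ring

theorem restrict_generator (i : Fin 2) : restrict (generator i) = X i := by
  apply MvPolynomial.funext
  intro y
  rw [eval_restrict, eval_X]
  obtain ⟨h0, h1⟩ := eval_sectionPoint_generator (-1 / 3 * y 0) (-1 / 27 * y 1)
  fin_cases i
  · exact h0.trans (by simp; ring)
  · exact h1.trans (by simp; ring)

theorem restrict_aeval_generator (q : MvPolynomial (Fin 2) ℂ) :
    restrict (aeval generator q) = q := by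
  rw [← AlgHom.comp_apply, MvPolynomial.comp_aeval]
  simp [restrict_generator]

theorem act_aeval_generator
    (g : Matrix.SpecialLinearGroup (Fin 2) ℂ × Matrix.SpecialLinearGroup (Fin 4) ℂ ×
      Matrix.SpecialLinearGroup (Fin 4) ℂ) (q : MvPolynomial (Fin 2) ℂ) :
    act 2 4 4 g (aeval generator q) = aeval generator q := by
  rw [← AlgHom.comp_apply, MvPolynomial.comp_aeval]
  simp [act_generator]

theorem aeval_generator_restrict {f : MvPolynomial (Fin 2 × Fin 4 × Fin 4) ℂ}
    (hf : ∀ g, act 2 4 4 g f = f) : aeval generator (restrict f) = f := by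
  refine (sub_eq_zero.1 (eq_zero_of_eval_sectionPoint
    (f := f - aeval generator (restrict f)) (fun g => ?_) fun p r => ?_)).symm
  · rw [map_sub, hf, act_aeval_generator]
  · have := eval_restrict ![-3 * p, -27 * r] (f - aeval generator (restrict f))
    rw [map_sub restrict, restrict_aeval_generator, sub_self, map_zero] at this
    convert this.symm using 3
    congr 1 <;> simp <;> ring

theorem mem_invSpace {n₁ n₂ n₃ d : ℕ} {f : MvPolynomial (Fin n₁ × Fin n₂ × Fin n₃) ℂ} :
    f ∈ invSpace n₁ n₂ n₃ d ↔ f.IsHomogeneous d ∧ ∀ g, act n₁ n₂ n₃ g f = f := by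
  simp [invSpace, mem_homogeneousSubmodule]

theorem isHomogeneous_aeval_generator_monomial (m : Fin 2 →₀ ℕ) (c : ℂ) :
    (aeval generator (monomial m c)).IsHomogeneous (8 * m 0 + 12 * m 1) := by
  have h := (isHomogeneous_C (R := ℂ) (Fin 2 × Fin 4 × Fin 4) c).mul
    ((isHomogeneous_generator_zero.pow (m 0)).mul (isHomogeneous_generator_one.pow (m 1)))
  rw [zero_add] at h
  rw [aeval_monomial, Finsupp.prod_fintype _ _ (by simp), Fin.prod_univ_two]
  exact h

/-- The monomials in the generators that have degree `d`. -/
def degreeMonomial (d : ℕ) (p : {p : ℕ × ℕ // 8 * p.1 + 12 * p.2 = d}) :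
    MvPolynomial (Fin 2 × Fin 4 × Fin 4) ℂ :=
  aeval generator (monomial (Finsupp.equivFunOnFinite.symm ![p.1.1, p.1.2]) (1 : ℂ))

theorem linearIndependent_degreeMonomial (d : ℕ) : LinearIndependent ℂ (degreeMonomial d) := by
  refine LinearIndependent.of_comp restrict.toLinearMap ?_
  have hinj : Function.Injective fun p : {p : ℕ × ℕ // 8 * p.1 + 12 * p.2 = d} =>
      (Finsupp.equivFunOnFinite.symm ![p.1.1, p.1.2] : Fin 2 →₀ ℕ) := by
    intro p q h
    have h := Finsupp.equivFunOnFinite.symm.injective h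
    exact Subtype.ext (Prod.ext (congrFun h 0) (congrFun h 1))
  have hcomp : restrict.toLinearMap ∘ degreeMonomial d = basisMonomials (Fin 2) ℂ ∘
      fun p => Finsupp.equivFunOnFinite.symm ![p.1.1, p.1.2] := by
    ext1 p
    rw [Function.comp_apply, Function.comp_apply, coe_basisMonomials]
    exact restrict_aeval_generator _
  rw [hcomp]
  exact (basisMonomials (Fin 2) ℂ).linearIndependent.comp _ hinj

theorem span_degreeMonomial (d : ℕ) :
    Submodule.span ℂ (Set.range (degreeMonomial d)) = invSpace 2 4 4 d := by
  apply le_antisymm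
  · rw [Submodule.span_le]
    rintro _ ⟨⟨p, rfl⟩, rfl⟩
    exact mem_invSpace.2 ⟨isHomogeneous_aeval_generator_monomial _ _,
      fun g => act_aeval_generator g _⟩
  · intro f hf
    obtain ⟨hd, hf⟩ := mem_invSpace.1 hf
    have hcomp : homogeneousComponent d f = f := by
      rw [homogeneousComponent_of_mem hd, if_pos rfl]
    rw [← hcomp, ← aeval_generator_restrict hf,
      (restrict f).as_sum, map_sum, map_sum]
    refine Submodule.sum_mem _ fun m _ => ?_
    rw [homogeneousComponent_of_mem (isHomogeneous_aeval_generator_monomial m _)]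
    split_ifs with h
    · have : aeval generator (monomial m (coeff m (restrict f))) =
          coeff m (restrict f) • degreeMonomial d ⟨(m 0, m 1), h.symm⟩ := by
        rw [degreeMonomial, ← map_smul, smul_monomial, smul_eq_mul, mul_one]
        have hm : m = Finsupp.equivFunOnFinite.symm ![m 0, m 1] := by
          ext i
          fin_cases i <;> rfl
        exact congrArg (fun k => aeval generator (monomial k (coeff m (restrict f)))) hm
      rw [this]
      exact Submodule.smul_mem _ _ (Submodule.subset_span ⟨_, rfl⟩)
    · exact Submodule.zero_mem _

theorem finite_degree_pairs (d : ℕ) : Finite {p : ℕ × ℕ // 8 * p.1 + 12 * p.2 = d} := by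
  refine Set.Finite.to_subtype (((Set.finite_Iic d).prod (Set.finite_Iic d)).subset ?_)
  rintro ⟨a, b⟩ h
  change 8 * a + 12 * b = d at h
  simp only [Set.mem_prod, Set.mem_Iic]
  omega

/-- for the action of `SL₂(ℂ) × SL₄(ℂ) × SL₄(ℂ)` on `ℂ[x_{ijk}]`, the space of invariant polynomials homogeneous of degree `d` has dimension equal to the number of pairs `(a,b) ∈ ℕ²` with `8a + 12b = d` (Kac: the invariant algebra is free on generators of degrees 8 and 12; affine Dynkin diagram `Ê₇`, generating series `1/((1-q²)(1-q³))` for `g((2n)²,n⁴,n⁴)`). -/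
theorem stmt18 (d : ℕ) :
    Module.rank ℂ ↥(invSpace 2 4 4 d) =
      (Nat.card {p : ℕ × ℕ // 8 * p.1 + 12 * p.2 = d} : Cardinal) := by
  have := finite_degree_pairs d
  rw [← span_degreeMonomial, rank_span (linearIndependent_degreeMonomial d),
    Cardinal.mk_range_eq _ (linearIndependent_degreeMonomial d).injective, Nat.cast_card]
end
end
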